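/- Let A be a unital commutative real algebra finitely generated by a_1, …, a_d, and L : A → ℝ linear with L(1) = 1. Suppose (a) L(q) ≥ 0 for all q in some quadratic module Q of A, and (b) for each i ∈ {1, …, d} the class C{√(L(a_i^{2n}))} is quasi-analytic. Then there exists a unique K_Q-representing Radon measure ν for L on the Borel σ-algebra of X(A), where K_Q = {α ∈ X(A) : α(q) ≥ 0 for all q ∈ Q}. -/

import Mathlib

open MeasureTheory
open scoped ENNReal

namespace Stmt18

/-- The weak topology on the character space `B →ₐ[ℝ] ℝ`. -/
instance charTopology (B : Type*) [CommRing B] [Algebra ℝ B] :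
    TopologicalSpace (B →ₐ[ℝ] ℝ) :=
  TopologicalSpace.induced (fun φ : B →ₐ[ℝ] ℝ => (φ : B → ℝ)) inferInstance

/-- The Borel σ-algebra of the weak topology on the character space. -/
instance charMeasurableSpace (B : Type*) [CommRing B] [Algebra ℝ B] :
    MeasurableSpace (B →ₐ[ℝ] ℝ) := borel _

instance charBorelSpace (B : Type*) [CommRing B] [Algebra ℝ B] :
    BorelSpace (B →ₐ[ℝ] ℝ) := ⟨rfl⟩

/-- The restriction map `π_S : X(A) → X(S)` for a subalgebra `S` of `A`. -/
def resMap {A : Type*} [CommRing A] [Algebra ℝ A] (S : Subalgebra ℝ A) :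
    (A →ₐ[ℝ] ℝ) → (S →ₐ[ℝ] ℝ) := fun φ => φ.comp S.val

/-- The restriction map `π_{S,T} : X(T) → X(S)` for subalgebras `S ≤ T` of `A`. -/
def resTrans {A : Type*} [CommRing A] [Algebra ℝ A] {S T : Subalgebra ℝ A} (h : S ≤ T) :
    (T →ₐ[ℝ] ℝ) → (S →ₐ[ℝ] ℝ) := fun φ => φ.comp (Subalgebra.inclusion h)

/-- The restriction `L|_S` of a linear functional `L : A → ℝ` to a subalgebra `S`. -/
def resL {A : Type*} [CommRing A] [Algebra ℝ A] (L : A →ₗ[ℝ] ℝ) (S : Subalgebra ℝ A) :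
    (↥S) →ₗ[ℝ] ℝ := L.comp (Subalgebra.val S).toLinearMap

/-- A Radon measure: locally finite and inner regular w.r.t. compact sets. -/
def IsRadon {α : Type*} [TopologicalSpace α] [MeasurableSpace α] (μ : Measure α) : Prop :=
  IsLocallyFiniteMeasure μ ∧ μ.InnerRegular

/-- `μ` is a `K`-representing Radon measure for the linear functional `L` on `B`. -/
def IsRepr {B : Type*} [CommRing B] [Algebra ℝ B] (L : B →ₗ[ℝ] ℝ)
    (K : Set (B →ₐ[ℝ] ℝ)) (μ : Measure (B →ₐ[ℝ] ℝ)) : Prop :=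
  IsRadon μ ∧ μ Kᶜ = 0 ∧
    ∀ b : B, Integrable (fun φ : B →ₐ[ℝ] ℝ => φ b) μ ∧
      L b = ∫ φ : B →ₐ[ℝ] ℝ, φ b ∂μ

/-- Prokhorov's condition for a family of measures indexed by the finitely generated
subalgebras of `A`. -/
def Prokh {A : Type*} [CommRing A] [Algebra ℝ A]
    (μf : ∀ S : Subalgebra ℝ A, Measure (↥S →ₐ[ℝ] ℝ)) : Prop :=
  ∀ ε : ℝ≥0∞, 0 < ε → ∃ C : Set (A →ₐ[ℝ] ℝ), IsCompact C ∧
    ∀ S : Subalgebra ℝ A, S.FG → 1 - ε ≤ μf S (resMap S '' C)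


/-- A quadratic module in a commutative real algebra `A`. -/
def IsQuadraticModule {A : Type*} [CommRing A] [Algebra ℝ A] (Q : Set A) : Prop :=
  (1 : A) ∈ Q ∧ (∀ x ∈ Q, ∀ y ∈ Q, x + y ∈ Q) ∧ ∀ (a : A), ∀ x ∈ Q, a ^ 2 * x ∈ Q

/-- The class `C{m_n}` of smooth functions whose derivatives satisfy
`‖f⁽ⁿ⁾‖_∞ ≤ γ^n m_n` for some `γ > 0`. -/
def QAClass (m : ℕ → ℝ) : Set (ℝ → ℝ) :=
  {f | ContDiff ℝ (⊤ : ℕ∞) f ∧ ∃ γ : ℝ, 0 < γ ∧ ∀ (n : ℕ) (x : ℝ), |iteratedDeriv n f x| ≤ γ ^ n * m n}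

/-- The class `C{m_n}` is quasi-analytic: any member all of whose derivatives vanish at `0`
vanishes identically. -/
def IsQuasiAnalytic (m : ℕ → ℝ) : Prop :=
  ∀ f ∈ QAClass m, (∀ n : ℕ, iteratedDeriv n f 0 = 0) → ∀ x : ℝ, f x = 0

section Moments

open Set Filter Topology

theorem iteratedDeriv_eq_of_hasDerivAt_chain {h : ℕ → ℝ → ℝ}
    (hh : ∀ n t, HasDerivAt (h n) (h (n + 1) t) t) (n : ℕ) : iteratedDeriv n (h 0) = h n := by
  induction n with
  | zero => simp
  | succ n ih =>
    rw [iteratedDeriv_succ, ih]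
    exact funext fun t => (hh n t).deriv

theorem contDiff_of_hasDerivAt_chain {h : ℕ → ℝ → ℝ}
    (hh : ∀ n t, HasDerivAt (h n) (h (n + 1) t) t) : ContDiff ℝ (⊤ : ℕ∞) (h 0) := by
  refine contDiff_of_differentiable_iteratedDeriv fun n _ => ?_
  rw [iteratedDeriv_eq_of_hasDerivAt_chain hh]
  exact fun t => (hh n t).differentiableAt

/-- A function vanishing together with its derivative at `0` may be glued with `0` there. -/
theorem hasDerivAt_indicator_Ioi {g g' : ℝ → ℝ} (hg : ∀ t, HasDerivAt g (g' t) t)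
    (h0 : g 0 = 0) (h0' : g' 0 = 0) (t : ℝ) :
    HasDerivAt ((Ioi 0).indicator g) ((Ioi 0).indicator g' t) t := by
  rcases lt_trichotomy t 0 with ht | rfl | ht
  · rw [indicator_of_notMem (by simpa using ht.le)]
    refine (hasDerivAt_const t (0 : ℝ)).congr_of_eventuallyEq ?_
    filter_upwards [Iio_mem_nhds ht] with s hs
    exact indicator_of_notMem (by simpa using (le_of_lt hs)) _
  · rw [indicator_of_notMem (by simp)]
    have h1 := hg 0
    rw [h0', hasDerivAt_iff_isLittleO] at h1
    rw [hasDerivAt_iff_isLittleO]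
    refine Asymptotics.IsBigO.trans_isLittleO (Asymptotics.IsBigO.of_bound 1 ?_) h1
    refine Eventually.of_forall fun s => ?_
    by_cases hs : s ∈ Ioi (0 : ℝ)
    · simp [indicator_of_mem hs, h0]
    · simp [indicator_of_notMem hs]
  · rw [indicator_of_mem (by simpa using ht)]
    refine (hg t).congr_of_eventuallyEq ?_
    filter_upwards [Ioi_mem_nhds ht] with s hs
    exact indicator_of_mem hs _

/-- Quasi-analyticity of `C{m_n}` forces flat functions whose derivatives are only controlled by
the shifted sequence `m_{n+1}` to vanish on the positive half-line. -/
theorem IsQuasiAnalytic.eq_zero_of_shift {m : ℕ → ℝ} (hm : IsQuasiAnalytic m) (hm0 : 0 < m 0)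
    (hmn : ∀ n, 0 ≤ m n) {h : ℕ → ℝ → ℝ} (hh : ∀ n t, HasDerivAt (h n) (h (n + 1) t) t)
    (h0 : ∀ n, h n 0 = 0)
    {C : ℝ} (hC : ∀ n t, |h n t| ≤ C * m (n + 1)) {t : ℝ} (ht : 0 ≤ t) : h 0 t = 0 := by
  set k : ℕ → ℝ → ℝ := fun n => (Ioi 0).indicator (h n) with hk
  have hkd : ∀ n t, HasDerivAt (k n) (k (n + 1) t) t := fun n t =>
    hasDerivAt_indicator_Ioi (hh n) (h0 n) (h0 (n + 1)) t
  have hkn : ∀ n t, t ≤ 0 → k n t = 0 := fun n t ht => indicator_of_notMem (by simpa using ht) _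
  have hkC : ∀ n t, |k n t| ≤ C * m (n + 1) := fun n t => by
    by_cases hs : t ∈ Ioi (0 : ℝ)
    · simpa [hk, indicator_of_mem hs] using hC n t
    · simpa [hk, indicator_of_notMem hs] using (abs_nonneg _).trans (hC n t)
  have hkc : Continuous (k 0) := continuous_iff_continuousAt.2 fun t => (hkd 0 t).continuousAt
  set I : ℝ → ℝ := fun t => ∫ s in (0 : ℝ)..t, k 0 s with hI
  have hId : ∀ t, HasDerivAt I (k 0 t) t := fun t =>
    (hkc.integral_hasStrictDerivAt 0 t).hasDerivAt
  set D : ℝ := 2 * |C| + |C * m 1| / m 0 + 1 with hD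
  have hDpos : 0 < D := by positivity
  have hD1 : 2 * |C| ≤ D := by
    have : 0 ≤ |C * m 1| / m 0 := by positivity
    linarith
  have hD2 : |C * m 1| / m 0 ≤ D := by
    have : 0 ≤ |C| := by positivity
    linarith
  let G : ℕ → ℝ → ℝ := fun n => match n with
    | 0 => fun t => D⁻¹ * (I t - I (t - 1))
    | n + 1 => fun t => D⁻¹ * (k n t - k n (t - 1))
  have hG : ∀ n t, HasDerivAt (G n) (G (n + 1) t) t := by
    intro n t
    cases n with
    | zero => exact ((hId t).sub ((hId (t - 1)).comp_sub_const t 1)).const_mul _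
    | succ n => exact ((hkd n t).sub ((hkd n (t - 1)).comp_sub_const t 1)).const_mul _
  have hmem : G 0 ∈ QAClass m := by
    refine ⟨contDiff_of_hasDerivAt_chain hG, 1, one_pos, fun n t => ?_⟩
    rw [iteratedDeriv_eq_of_hasDerivAt_chain hG, one_pow, one_mul]
    cases n with
    | zero =>
      have h1 : I t - I (t - 1) = ∫ s in (t - 1)..t, k 0 s :=
        intervalIntegral.integral_interval_sub_left (hkc.intervalIntegrable _ _)
          (hkc.intervalIntegrable _ _)
      have h2 : ‖∫ s in (t - 1)..t, k 0 s‖ ≤ (C * m 1) * |t - (t - 1)| :=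
        intervalIntegral.norm_integral_le_of_norm_le_const fun s _ => hkC 0 s
      have h3 : |t - (t - 1)| = 1 := by simp
      rw [h3, mul_one, Real.norm_eq_abs] at h2
      change |D⁻¹ * (I t - I (t - 1))| ≤ m 0
      rw [abs_mul, abs_of_pos (inv_pos.2 hDpos), h1, inv_mul_le_iff₀ hDpos]
      exact h2.trans ((le_abs_self _).trans ((div_le_iff₀ hm0).1 hD2))
    | succ n =>
      change |D⁻¹ * (k n t - k n (t - 1))| ≤ m (n + 1)
      rw [abs_mul, abs_of_pos (inv_pos.2 hDpos), inv_mul_le_iff₀ hDpos]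
      have h1 : |k n t - k n (t - 1)| ≤ 2 * (C * m (n + 1)) := by
        have := abs_sub (k n t) (k n (t - 1))
        linarith [hkC n t, hkC n (t - 1)]
      have h2 := mul_le_mul_of_nonneg_right (le_abs_self C) (hmn (n + 1))
      have h3 := mul_le_mul_of_nonneg_right hD1 (hmn (n + 1))
      linarith
  have hzero : ∀ t, G 0 t = 0 := by
    refine hm _ hmem fun n => ?_
    rw [iteratedDeriv_eq_of_hasDerivAt_chain hG]
    cases n with
    | zero =>
      have : ∫ s in (0 - 1 : ℝ)..0, k 0 s = 0 := by
        rw [intervalIntegral.integral_congr (g := fun _ => (0 : ℝ)), intervalIntegral.integral_zero]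
        intro s hs
        rw [uIcc_of_le (by norm_num)] at hs
        exact hkn 0 s hs.2
      have h1 : I 0 - I (0 - 1) = ∫ s in (0 - 1 : ℝ)..0, k 0 s :=
        intervalIntegral.integral_interval_sub_left (hkc.intervalIntegrable _ _)
          (hkc.intervalIntegrable _ _)
      change D⁻¹ * (I 0 - I (0 - 1)) = 0
      rw [h1, this, mul_zero]
    | succ n =>
      change D⁻¹ * (k n 0 - k n (0 - 1)) = 0
      rw [hkn n 0 le_rfl, hkn n (0 - 1) (by norm_num)]
      simp
  have hper : ∀ t, k 0 t = k 0 (t - 1) := by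
    intro t
    have h1 : HasDerivAt (G 0) 0 t := by
      rw [show G 0 = fun _ => 0 from funext hzero]
      exact hasDerivAt_const t 0
    have h2 : D⁻¹ * (k 0 t - k 0 (t - 1)) = 0 := (hG 0 t).unique h1
    have := (mul_eq_zero.1 h2).resolve_left (inv_ne_zero hDpos.ne')
    linarith
  have hN : ∀ N : ℕ, ∀ t : ℝ, t ≤ N → k 0 t = 0 := by
    intro N
    induction N with
    | zero => exact fun t ht => hkn 0 t (by simpa using ht)
    | succ N ih =>
      intro t ht
      rw [hper]
      exact ih _ (by push_cast at ht; linarith)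
  obtain ⟨N, hN'⟩ := exists_nat_ge t
  rcases ht.eq_or_lt with rfl | ht
  · exact h0 0
  · rw [← hN N t hN', hk]
    exact (indicator_of_mem (by simpa using ht) _).symm

/-- A weight sequence with quasi-analytic class, with the mild growth property shared by all
sequences `√(L(a^{2n}))`. -/
structure QAWeight (m : ℕ → ℝ) : Prop where
  quasiAnalytic : IsQuasiAnalytic m
  zero_pos : 0 < m 0
  nonneg : ∀ n, 0 ≤ m n
  growth : m 2 = 0 ∨ ∃ κ : ℝ, 0 < κ ∧ ∀ n, κ * m n ≤ m (n + 1)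

section Core

variable {Ω : Type*} [MeasurableSpace Ω] {μ μ₁ μ₂ : Measure Ω} {p y θ : Ω → ℝ}

theorem integrable_mul_cos {f g : Ω → ℝ} (hf : Integrable f μ) (hg : Measurable g) :
    Integrable (fun ω => f ω * Real.cos (g ω)) μ :=
  hf.mul_bdd (c := 1) (Real.measurable_cos.comp hg).aestronglyMeasurable
    (Eventually.of_forall fun ω => by simpa using Real.abs_cos_le_one (g ω))

theorem hasDerivAt_integral_cos (hy : Measurable y) (hθ : Measurable θ)
    (hInt : ∀ n : ℕ, Integrable (fun ω => p ω * y ω ^ n) μ) (n : ℕ) (t : ℝ) :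
    HasDerivAt (fun t : ℝ => ∫ ω, p ω * y ω ^ n * Real.cos (θ ω + t * y ω + n * (Real.pi / 2)) ∂μ)
      (∫ ω, p ω * y ω ^ (n + 1) *
        Real.cos (θ ω + t * y ω + ((n + 1 : ℕ) : ℝ) * (Real.pi / 2)) ∂μ) t := by
  have hmeas : ∀ (n : ℕ) (t : ℝ),
      Measurable fun ω => θ ω + t * y ω + (n : ℝ) * (Real.pi / 2) := fun n t => by fun_prop
  refine (hasDerivAt_integral_of_dominated_loc_of_deriv_le (μ := μ) (s := univ)
    (F := fun (t : ℝ) ω => p ω * y ω ^ n * Real.cos (θ ω + t * y ω + n * (Real.pi / 2)))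
    (F' := fun (t : ℝ) ω => p ω * y ω ^ (n + 1) *
        Real.cos (θ ω + t * y ω + ((n + 1 : ℕ) : ℝ) * (Real.pi / 2)))
    (bound := fun ω => |p ω * y ω ^ (n + 1)|) univ_mem ?_ ?_ ?_ ?_ ?_ ?_).2
  · exact Eventually.of_forall fun t =>
      (integrable_mul_cos (hInt n) (hmeas n t)).aestronglyMeasurable
  · exact integrable_mul_cos (hInt n) (hmeas n t)
  · exact (integrable_mul_cos (hInt (n + 1)) (hmeas (n + 1) t)).aestronglyMeasurable
  · refine Eventually.of_forall fun ω s _ => ?_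
    rw [norm_mul, Real.norm_eq_abs, Real.norm_eq_abs]
    exact mul_le_of_le_one_right (abs_nonneg _) (Real.abs_cos_le_one _)
  · exact (hInt (n + 1)).abs
  · refine Eventually.of_forall fun ω s _ => ?_
    have h1 : HasDerivAt (fun t : ℝ => θ ω + t * y ω + n * (Real.pi / 2)) (y ω) s := by
      simpa using (((hasDerivAt_id s).mul_const (y ω)).const_add (θ ω)).add_const
        ((n : ℝ) * (Real.pi / 2))
    have h2 := (h1.cos).const_mul (p ω * y ω ^ n)
    refine h2.congr_deriv ?_
    have : θ ω + s * y ω + ((n + 1 : ℕ) : ℝ) * (Real.pi / 2)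
        = (θ ω + s * y ω + n * (Real.pi / 2)) + Real.pi / 2 := by push_cast; ring
    rw [this, Real.cos_add_pi_div_two]
    ring

theorem exists_integral_abs_le_shift {m : ℕ → ℝ} (hmn : ∀ n, 0 ≤ m n) {κ : ℝ} (hκ : 0 < κ)
    (hgrow : ∀ n, κ * m n ≤ m (n + 1))
    (hInt : ∀ n : ℕ, Integrable (fun ω => p ω * y ω ^ n) μ)
    (hB : ∃ C, ∀ k : ℕ, ∫ ω, |p ω| * y ω ^ (2 * k) ∂μ ≤ C * m (2 * k)) :
    ∃ C, ∀ n : ℕ, ∫ ω, |p ω * y ω ^ n| ∂μ ≤ C * m (n + 1) := by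
  obtain ⟨C, hC⟩ := hB
  have hC' : ∀ k, ∫ ω, |p ω| * y ω ^ (2 * k) ∂μ ≤ |C| * m (2 * k) := fun k =>
    (hC k).trans (mul_le_mul_of_nonneg_right (le_abs_self C) (hmn _))
  have hg : ∀ n, m n ≤ κ⁻¹ * m (n + 1) := fun n => by
    rw [← div_eq_inv_mul, le_div_iff₀ hκ, mul_comm]; exact hgrow n
  have heven : ∀ k ω, |p ω * y ω ^ (2 * k)| = |p ω| * y ω ^ (2 * k) := fun k ω => by
    rw [abs_mul, abs_of_nonneg (a := y ω ^ (2 * k)) (by rw [pow_mul]; positivity)]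
  have hi : ∀ k, Integrable (fun ω => |p ω| * y ω ^ (2 * k)) μ := fun k => by
    simpa only [heven] using (hInt (2 * k)).abs
  refine ⟨|C| * (κ⁻¹ + κ⁻¹ * κ⁻¹ + 1), fun n => ?_⟩
  have hκ' : 0 < κ⁻¹ := inv_pos.2 hκ
  have hC0 : 0 ≤ |C| := abs_nonneg C
  have hm1 := mul_nonneg hC0 (hmn (n + 1))
  rcases Nat.even_or_odd' n with ⟨k, rfl | rfl⟩
  · simp only [heven]
    refine (hC' k).trans ?_
    have h1 := mul_le_mul_of_nonneg_left (hg (2 * k)) hC0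
    have h2 := mul_nonneg (mul_nonneg hκ'.le hκ'.le) hm1
    nlinarith
  · have h1 : ∫ ω, |p ω * y ω ^ (2 * k + 1)| ∂μ
        ≤ ∫ ω, (|p ω| * y ω ^ (2 * k) + |p ω| * y ω ^ (2 * (k + 1))) ∂μ := by
      refine integral_mono (hInt (2 * k + 1)).abs ((hi k).add (hi (k + 1))) fun ω => ?_
      have h3 : |y ω| ≤ 1 + y ω ^ 2 := by nlinarith [sq_abs (y ω), sq_nonneg (|y ω| - 1)]
      have h4 : 0 ≤ |p ω| * y ω ^ (2 * k) := by rw [← heven]; positivity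
      calc |p ω * y ω ^ (2 * k + 1)| = |p ω * y ω ^ (2 * k)| * |y ω| := by
            rw [← abs_mul]; ring_nf
        _ ≤ |p ω| * y ω ^ (2 * k) * (1 + y ω ^ 2) := by
            rw [heven]; exact mul_le_mul_of_nonneg_left h3 h4
        _ = _ := by ring
    rw [integral_add (hi k) (hi (k + 1))] at h1
    have h2 := hg (2 * k)
    have h3 := mul_le_mul_of_nonneg_left (hg (2 * k + 1)) hκ'.le
    have h4 := mul_le_mul_of_nonneg_left (h2.trans h3) hC0
    have h5 := hC' k
    have h6 := hC' (k + 1)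
    rw [show 2 * (k + 1) = 2 * k + 1 + 1 by ring] at h6 h1
    have h7 := mul_nonneg hκ'.le hm1
    nlinarith

theorem integral_cos_eq_of_nonneg {m : ℕ → ℝ} (hm : QAWeight m)
    (hy : Measurable y) (hθ : Measurable θ)
    (hInt₁ : ∀ n : ℕ, Integrable (fun ω => p ω * y ω ^ n) μ₁)
    (hInt₂ : ∀ n : ℕ, Integrable (fun ω => p ω * y ω ^ n) μ₂)
    (hB₁ : ∃ C, ∀ k : ℕ, ∫ ω, |p ω| * y ω ^ (2 * k) ∂μ₁ ≤ C * m (2 * k))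
    (hB₂ : ∃ C, ∀ k : ℕ, ∫ ω, |p ω| * y ω ^ (2 * k) ∂μ₂ ≤ C * m (2 * k))
    (heq : ∀ (n : ℕ) (c : ℝ), ∫ ω, p ω * y ω ^ n * Real.cos (θ ω + c) ∂μ₁
      = ∫ ω, p ω * y ω ^ n * Real.cos (θ ω + c) ∂μ₂) {t : ℝ} (ht : 0 ≤ t) :
    ∫ ω, p ω * Real.cos (θ ω + t * y ω) ∂μ₁ = ∫ ω, p ω * Real.cos (θ ω + t * y ω) ∂μ₂ := by
  rcases hm.growth with hm2 | ⟨κ, hκ, hgrow⟩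
  · have key : ∀ μ : Measure Ω, (∀ n : ℕ, Integrable (fun ω => p ω * y ω ^ n) μ) →
        (∃ C, ∀ k : ℕ, ∫ ω, |p ω| * y ω ^ (2 * k) ∂μ ≤ C * m (2 * k)) →
        ∫ ω, p ω * Real.cos (θ ω + t * y ω) ∂μ = ∫ ω, p ω * y ω ^ 0 * Real.cos (θ ω + 0) ∂μ := by
      rintro μ hInt ⟨C, hC⟩
      have h1 := hC 1
      rw [mul_one, hm2, mul_zero] at h1
      have h2 : ∀ ω, 0 ≤ |p ω| * y ω ^ 2 := fun ω => by positivity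
      have h3 : Integrable (fun ω => |p ω| * y ω ^ 2) μ := by
        simpa [abs_mul] using (hInt 2).abs
      have h4 := (integral_eq_zero_iff_of_nonneg h2 h3).1
        (le_antisymm h1 (integral_nonneg h2))
      refine integral_congr_ae ?_
      filter_upwards [h4] with ω hω
      rcases mul_eq_zero.1 hω with h | h
      · simp [abs_eq_zero.1 h]
      · simp [pow_eq_zero_iff (two_ne_zero) |>.1 h]
    rw [key μ₁ hInt₁ hB₁, key μ₂ hInt₂ hB₂, heq 0 0]
  · obtain ⟨C₁, hC₁⟩ := exists_integral_abs_le_shift hm.nonneg hκ hgrow hInt₁ hB₁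
    obtain ⟨C₂, hC₂⟩ := exists_integral_abs_le_shift hm.nonneg hκ hgrow hInt₂ hB₂
    let F : Measure Ω → ℕ → ℝ → ℝ := fun μ n t =>
      ∫ ω, p ω * y ω ^ n * Real.cos (θ ω + t * y ω + n * (Real.pi / 2)) ∂μ
    have hFb : ∀ (μ : Measure Ω) (n : ℕ) (t : ℝ), Integrable (fun ω => p ω * y ω ^ n) μ →
        |F μ n t| ≤ ∫ ω, |p ω * y ω ^ n| ∂μ := by
      intro μ n t hi
      refine (abs_integral_le_integral_abs).trans ?_
      refine integral_mono (integrable_mul_cos hi (by fun_prop)).abs hi.abs fun ω => ?_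
      simp only [abs_mul (p ω * y ω ^ n)]
      exact mul_le_of_le_one_right (abs_nonneg _) (Real.abs_cos_le_one _)
    have := hm.quasiAnalytic.eq_zero_of_shift hm.zero_pos hm.nonneg
      (h := fun n t => F μ₁ n t - F μ₂ n t)
      (fun n t => (hasDerivAt_integral_cos hy hθ hInt₁ n t).sub
        (hasDerivAt_integral_cos hy hθ hInt₂ n t))
      (fun n => by
        have := heq n (n * (Real.pi / 2))
        simp only [F, zero_mul, add_zero]
        rw [this, sub_self])
      (C := C₁ + C₂)
      (fun n t => by
        have h1 := abs_sub (F μ₁ n t) (F μ₂ n t)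
        have h2 := (hFb μ₁ n t (hInt₁ n)).trans (hC₁ n)
        have h3 := (hFb μ₂ n t (hInt₂ n)).trans (hC₂ n)
        simp only [F] at h1 h2 h3 ⊢
        linarith) ht
    simpa [F, sub_eq_zero] using this

/-- If all the integrals `∫ p yⁿ cos(θ + c)` agree for two measures and the even absolute moments
are controlled by a quasi-analytic weight, then the integrals `∫ p cos(θ + t y)` agree. -/
theorem integral_cos_eq {m : ℕ → ℝ} (hm : QAWeight m)
    (hy : Measurable y) (hθ : Measurable θ)
    (hInt₁ : ∀ n : ℕ, Integrable (fun ω => p ω * y ω ^ n) μ₁)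
    (hInt₂ : ∀ n : ℕ, Integrable (fun ω => p ω * y ω ^ n) μ₂)
    (hB₁ : ∃ C, ∀ k : ℕ, ∫ ω, |p ω| * y ω ^ (2 * k) ∂μ₁ ≤ C * m (2 * k))
    (hB₂ : ∃ C, ∀ k : ℕ, ∫ ω, |p ω| * y ω ^ (2 * k) ∂μ₂ ≤ C * m (2 * k))
    (heq : ∀ (n : ℕ) (c : ℝ), ∫ ω, p ω * y ω ^ n * Real.cos (θ ω + c) ∂μ₁
      = ∫ ω, p ω * y ω ^ n * Real.cos (θ ω + c) ∂μ₂) (t : ℝ) :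
    ∫ ω, p ω * Real.cos (θ ω + t * y ω) ∂μ₁ = ∫ ω, p ω * Real.cos (θ ω + t * y ω) ∂μ₂ := by
  rcases le_total 0 t with ht | ht
  · exact integral_cos_eq_of_nonneg hm hy hθ hInt₁ hInt₂ hB₁ hB₂ heq ht
  · have hneg : ∀ (n : ℕ) ω, p ω * (-y ω) ^ n = (-1) ^ n * (p ω * y ω ^ n) := fun n ω => by
      rw [neg_pow]; ring
    have := integral_cos_eq_of_nonneg (p := p) (y := fun ω => -y ω) hm hy.neg hθ
      (fun n => by simpa only [hneg] using (hInt₁ n).const_mul _)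
      (fun n => by simpa only [hneg] using (hInt₂ n).const_mul _)
      (by simpa [pow_mul] using hB₁) (by simpa [pow_mul] using hB₂)
      (fun n c => by
        simp only [hneg, mul_assoc, integral_const_mul]
        simp only [← mul_assoc, heq n c]) (neg_nonneg.2 ht)
    simpa using this

end Core

theorem integral_cexp_eq_of_integral_cos_eq {Ω : Type*} [MeasurableSpace Ω] {μ₁ μ₂ : Measure Ω}
    [IsFiniteMeasure μ₁] [IsFiniteMeasure μ₂] {g : Ω → ℝ} (hg : Measurable g)
    (h : ∀ c : ℝ, ∫ ω, Real.cos (g ω + c) ∂μ₁ = ∫ ω, Real.cos (g ω + c) ∂μ₂) :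
    ∫ ω, Complex.exp (g ω * Complex.I) ∂μ₁ = ∫ ω, Complex.exp (g ω * Complex.I) ∂μ₂ := by
  have key : ∀ μ : Measure Ω, IsFiniteMeasure μ → ∫ ω, Complex.exp (g ω * Complex.I) ∂μ
      = ((∫ ω, Real.cos (g ω + 0) ∂μ : ℝ) : ℂ)
        + ((∫ ω, Real.cos (g ω + -(Real.pi / 2)) ∂μ : ℝ) : ℂ) * Complex.I := by
    intro μ _
    have hi : ∀ c, Integrable (fun ω => Real.cos (g ω + c)) μ := fun c => by
      simpa using integrable_mul_cos (integrable_const (1 : ℝ)) (hg.add_const c) (μ := μ)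
    rw [← integral_complex_ofReal, ← integral_complex_ofReal, ← integral_mul_const, ← integral_add]
    · refine integral_congr_ae (Eventually.of_forall fun ω => ?_)
      simp only [add_zero, ← sub_eq_add_neg, Real.cos_sub_pi_div_two]
      rw [Complex.exp_mul_I]
      push_cast
      rfl
    · exact (hi 0).ofReal
    · exact (hi _).ofReal.mul_const _
  rw [key μ₁ inferInstance, key μ₂ inferInstance, h, h]

/-- A finite measure on the line with finite moments whose even moments are controlled by `m`. -/
structure Tame (m : ℕ → ℝ) (μ : Measure ℝ) : Prop where
  finite : IsFiniteMeasure μ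
  integrable : ∀ n : ℕ, Integrable (fun x : ℝ => x ^ n) μ
  bound : ∃ C, ∀ k : ℕ, ∫ x : ℝ, x ^ (2 * k) ∂μ ≤ C * m (2 * k)

theorem Tame.ext {m : ℕ → ℝ} (hm : QAWeight m) {μ₁ μ₂ : Measure ℝ} (h₁ : Tame m μ₁)
    (h₂ : Tame m μ₂) (h : ∀ n : ℕ, ∫ x : ℝ, x ^ n ∂μ₁ = ∫ x : ℝ, x ^ n ∂μ₂) : μ₁ = μ₂ := by
  have := h₁.finite
  have := h₂.finite
  refine Measure.ext_of_charFun (funext fun t => ?_)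
  simp only [charFun_apply_real]
  have := integral_cexp_eq_of_integral_cos_eq (μ₁ := μ₁) (μ₂ := μ₂) (g := fun x => t * x)
    (by fun_prop) fun c => by
      have := integral_cos_eq (μ₁ := μ₁) (μ₂ := μ₂) (p := fun _ => 1) (y := fun x => x)
        (θ := fun _ => c) hm measurable_id measurable_const (by simpa using h₁.integrable)
        (by simpa using h₂.integrable) (by simpa using h₁.bound) (by simpa using h₂.bound)
        (fun n c => by simp only [one_mul, integral_mul_const, h n]) t
      simpa [add_comm] using this
  simpa using this

theorem Tame.add {m : ℕ → ℝ} {μ₁ μ₂ : Measure ℝ} (h₁ : Tame m μ₁) (h₂ : Tame m μ₂) :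
    Tame m (μ₁ + μ₂) := by
  have := h₁.finite
  have := h₂.finite
  obtain ⟨C₁, hC₁⟩ := h₁.bound
  obtain ⟨C₂, hC₂⟩ := h₂.bound
  refine ⟨inferInstance, fun n => (h₁.integrable n).add_measure (h₂.integrable n),
    C₁ + C₂, fun k => ?_⟩
  rw [integral_add_measure (h₁.integrable _) (h₂.integrable _)]
  linarith [hC₁ k, hC₂ k]

theorem Tame.smul {m : ℕ → ℝ} {μ : Measure ℝ} (h : Tame m μ) (c : NNReal) :
    Tame m (c • μ) := by
  have := h.finite
  obtain ⟨C, hC⟩ := h.bound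
  refine ⟨inferInstance, fun n => (h.integrable n).smul_measure_nnreal, c * C, fun k => ?_⟩
  rw [integral_smul_nnreal_measure, NNReal.smul_def, smul_eq_mul, mul_assoc]
  exact mul_le_mul_of_nonneg_left (hC k) c.2

section Multivariate

variable {d : ℕ}

open MvPolynomial in
/-- A finite measure on `ℝᵈ` with finite moments whose even moments in each direction, also after
multiplication by the square of a polynomial, are controlled by `m`. -/
structure MvTame (m : Fin d → ℕ → ℝ) (μ : Measure (Fin d → ℝ)) : Prop where
  finite : IsFiniteMeasure μ
  integrable : ∀ p : MvPolynomial (Fin d) ℝ, Integrable (fun x => eval x p) μ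
  bound : ∀ (p : MvPolynomial (Fin d) ℝ) (i : Fin d), ∃ C, ∀ k : ℕ,
    ∫ x, eval x (p ^ 2 * X i ^ (2 * k)) ∂μ ≤ C * m i (2 * k)

open MvPolynomial in
theorem MvTame.abs_bound {m : Fin d → ℕ → ℝ} {μ : Measure (Fin d → ℝ)} (h : MvTame m μ)
    (p : MvPolynomial (Fin d) ℝ) (i : Fin d) :
    ∃ C, ∀ k : ℕ, ∫ x, |eval x p| * x i ^ (2 * k) ∂μ ≤ C * m i (2 * k) := by
  obtain ⟨C₁, hC₁⟩ := h.bound 1 i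
  obtain ⟨C₂, hC₂⟩ := h.bound p i
  refine ⟨C₁ + C₂, fun k => ?_⟩
  have h1 : Integrable (fun x => |eval x p| * x i ^ (2 * k)) μ := by
    have := (h.integrable (p * X i ^ (2 * k))).abs
    simpa [abs_mul, pow_mul] using this
  have h2 : ∫ x, |eval x p| * x i ^ (2 * k) ∂μ
      ≤ ∫ x, (eval x (1 ^ 2 * X i ^ (2 * k)) + eval x (p ^ 2 * X i ^ (2 * k))) ∂μ := by
    refine integral_mono h1 ((h.integrable _).add (h.integrable _)) fun x => ?_
    have h3 : |eval x p| ≤ 1 + eval x p ^ 2 := by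
      nlinarith [sq_abs (eval x p), sq_nonneg (|eval x p| - 1)]
    have h4 : 0 ≤ x i ^ (2 * k) := by rw [pow_mul]; positivity
    have := mul_le_mul_of_nonneg_right h3 h4
    simp only [map_mul, map_pow, eval_X, map_one]
    linarith
  rw [integral_add (h.integrable _) (h.integrable _)] at h2
  linarith [hC₁ k, hC₂ k]

open MvPolynomial in
theorem MvTame.integral_cos_eq {m : Fin d → ℕ → ℝ} (hm : ∀ i, QAWeight (m i))
    {μ₁ μ₂ : Measure (Fin d → ℝ)} (h₁ : MvTame m μ₁) (h₂ : MvTame m μ₂)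
    (h : ∀ p : MvPolynomial (Fin d) ℝ, ∫ x, eval x p ∂μ₁ = ∫ x, eval x p ∂μ₂)
    (S : Finset (Fin d)) (t : Fin d → ℝ) (p : MvPolynomial (Fin d) ℝ) (c : ℝ) :
    ∫ x, eval x p * Real.cos (∑ i ∈ S, t i * x i + c) ∂μ₁
      = ∫ x, eval x p * Real.cos (∑ i ∈ S, t i * x i + c) ∂μ₂ := by
  classical
  induction S using Finset.induction_on generalizing p c with
  | empty => simp only [Finset.sum_empty, integral_mul_const, h]
  | insert i S hi ih =>
    have hp : ∀ (n : ℕ) (x : Fin d → ℝ), eval x (p * X i ^ n) = eval x p * x i ^ n :=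
      fun n x => by simp
    have := Stmt18.integral_cos_eq (μ₁ := μ₁) (μ₂ := μ₂) (p := fun x => eval x p)
      (y := fun x => x i) (θ := fun x => ∑ i ∈ S, t i * x i + c) (hm i) (measurable_pi_apply i)
      (by fun_prop)
      (fun n => (h₁.integrable (p * X i ^ n)).congr (.of_forall (hp n)))
      (fun n => (h₂.integrable (p * X i ^ n)).congr (.of_forall (hp n)))
      (h₁.abs_bound p i) (h₂.abs_bound p i)
      (fun n c' => by
        have := ih (p * X i ^ n) (c + c')
        simp_rw [hp] at this
        simpa only [add_assoc] using this) (t i)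
    simp only [Finset.sum_insert hi]
    convert this using 4 <;> ring_nf

open MvPolynomial in
theorem MvTame.ext {m : Fin d → ℕ → ℝ} (hm : ∀ i, QAWeight (m i))
    {μ₁ μ₂ : Measure (Fin d → ℝ)} (h₁ : MvTame m μ₁) (h₂ : MvTame m μ₂)
    (h : ∀ p : MvPolynomial (Fin d) ℝ, ∫ x, eval x p ∂μ₁ = ∫ x, eval x p ∂μ₂) : μ₁ = μ₂ := by
  have := h₁.finite
  have := h₂.finite
  refine Measure.ext_of_charFunDual (funext fun ℓ => ?_)
  simp only [charFunDual_apply]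
  refine integral_cexp_eq_of_integral_cos_eq ℓ.continuous.measurable fun c => ?_
  have hℓ : ∀ x, ℓ x = ∑ i, (fun i => ℓ (Pi.single i 1)) i * x i := fun x => by
    conv_lhs => rw [← Finset.univ_sum_single x, map_sum]
    refine Finset.sum_congr rfl fun i _ => ?_
    rw [mul_comm, ← smul_eq_mul, ← map_smul, ← Pi.single_smul, smul_eq_mul, mul_one]
  generalize (fun i => ℓ (Pi.single i 1)) = τ at hℓ
  have := MvTame.integral_cos_eq hm h₁ h₂ h Finset.univ τ 1 c
  simpa [hℓ] using this

end Multivariate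

section Haviland

open scoped CompactlySupported

variable {Y : Type*} [TopologicalSpace Y] {A : Type*} [CommRing A] [Algebra ℝ A]

/-- A functional which is nonnegative on the elements of `A` that are nonnegative on `Y` extends to
a positive functional on `C_c(Y, ℝ) × A`. -/
theorem exists_positive_extension (ev : Y → A →ₐ[ℝ] ℝ) (L : A →ₗ[ℝ] ℝ)
    (hL : ∀ v, (∀ y, 0 ≤ ev y v) → 0 ≤ L v) :
    ∃ g : C_c(Y, ℝ) × A →ₗ[ℝ] ℝ, (∀ v, g (0, v) = L v) ∧
      ∀ (f : C_c(Y, ℝ)) (v : A), (∀ y, 0 ≤ f y + ev y v) → 0 ≤ g (f, v) := by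
  let s : PointedCone ℝ (C_c(Y, ℝ) × A) :=
    { carrier := {x | ∀ y, 0 ≤ x.1 y + ev y x.2}
      zero_mem' := fun y => by simp
      add_mem' := fun {a b} ha hb y => by
        have := ha y
        have := hb y
        simp only [Prod.fst_add, Prod.snd_add, CompactlySupportedContinuousMap.add_apply, map_add]
        linarith
      smul_mem' := fun c x hx y => by
        have h : 0 ≤ (c : ℝ) * (x.1 y + ev y x.2) := mul_nonneg c.2 (hx y)
        have h2 : ((c • x).1 y + ev y (c • x).2) = (c : ℝ) * (x.1 y + ev y x.2) := by
          change (c : ℝ) • x.1 y + ev y ((c : ℝ) • x.2) = _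
          rw [map_smul, smul_eq_mul, smul_eq_mul, mul_add]
        rw [h2]
        exact h }
  let f : (C_c(Y, ℝ) × A) →ₗ.[ℝ] ℝ :=
    { domain := (⊥ : Submodule ℝ C_c(Y, ℝ)).prod ⊤
      toFun := (L ∘ₗ LinearMap.snd ℝ _ _) ∘ₗ Submodule.subtype _ }
  obtain ⟨g, hg, hgs⟩ := riesz_extension s f (fun x hx => hL _ fun y => by
      have h0 : (x : C_c(Y, ℝ) × A).1 = 0 := by simpa using x.2.1
      have := hx y
      rw [h0] at this
      simpa using this) (fun x => by
      obtain ⟨C, hC⟩ := x.1.hasCompactSupport.exists_bound_of_continuous x.1.continuous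
      refine ⟨⟨(0, algebraMap ℝ A C - x.2), by simp [f]⟩, fun y => ?_⟩
      have := neg_le_of_abs_le (hC y)
      simp
      linarith)
  refine ⟨g, fun v => ?_, fun φ v h => hgs _ h⟩
  exact hg ⟨(0, v), by simp [f]⟩

/-- The product of a compactly supported function with the function defined by `v`. -/
def cutoff (ev : Y → A →ₐ[ℝ] ℝ) (hcont : ∀ v, Continuous fun y => ev y v) (χ : C_c(Y, ℝ)) (v : A) :
    C_c(Y, ℝ) :=
  ⟨⟨fun y => χ y * ev y v, χ.continuous.mul (hcont v)⟩, χ.hasCompactSupport.mul_right⟩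

/-- A form of Haviland's theorem. -/
theorem exists_measure_of_nonneg [T2Space Y] [LocallyCompactSpace Y] [SigmaCompactSpace Y]
    [MeasurableSpace Y] [BorelSpace Y] (ev : Y → A →ₐ[ℝ] ℝ)
    (hcont : ∀ v, Continuous fun y => ev y v) (w : A) (hw : ∀ y, 0 ≤ ev y w)
    (hcoer : ∀ R : ℝ, ∃ K : Set Y, IsCompact K ∧ ∀ y ∉ K, R ≤ ev y w) (L : A →ₗ[ℝ] ℝ)
    (hL : ∀ v, (∀ y, 0 ≤ ev y v) → 0 ≤ L v) :
    ∃ μ : Measure Y, ∀ v, Integrable (fun y => ev y v) μ ∧ ∫ y, ev y v ∂μ = L v := by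
  obtain ⟨g, hgL, hg⟩ := exists_positive_extension ev L hL
  let Λ : C_c(Y, ℝ) →ₚ[ℝ] ℝ := PositiveLinearMap.mk₀ (g ∘ₗ LinearMap.inl ℝ _ _) fun f hf =>
    hg f 0 fun y => by simpa using hf y
  let μ : Measure Y := RealRMK.rieszMeasure Λ
  have hμ : ∀ f : C_c(Y, ℝ), ∫ y, f y ∂μ = g (f, 0) := fun f => RealRMK.integral_rieszMeasure Λ f
  let K : CompactExhaustion Y := default
  have hχ : ∀ n, ∃ χ : C_c(Y, ℝ), (∀ y ∈ K n, χ y = 1) ∧ ∀ y, 0 ≤ χ y ∧ χ y ≤ 1 := fun n => by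
    obtain ⟨f, h1, -, h2, h3⟩ := exists_continuous_one_zero_of_isCompact (K.isCompact n)
      isClosed_empty (disjoint_empty _)
    exact ⟨⟨f, h2⟩, fun y hy => h1 hy, h3⟩
  choose χ hχ1 hχ01 using hχ
  have hev : ∀ y v, ∀ᶠ n in atTop, χ n y * ev y v = ev y v := fun y v => by
    obtain ⟨N, hN⟩ := K.exists_mem y
    filter_upwards [eventually_ge_atTop N] with n hn
    rw [hχ1 n y (K.subset hn hN), one_mul]
  have hcut : ∀ n v, ∫ y, χ n y * ev y v ∂μ = g (cutoff ev hcont (χ n) v, 0) :=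
    fun n v => hμ (cutoff ev hcont (χ n) v)
  have hcutint : ∀ n v, Integrable (fun y => χ n y * ev y v) μ := fun n v =>
    (cutoff ev hcont (χ n) v).continuous.integrable_of_hasCompactSupport
      (cutoff ev hcont (χ n) v).hasCompactSupport
  have hsplit : ∀ f v, g (f, v) = g (f, 0) + L v := fun f v => by
    rw [← hgL v, ← map_add]; simp
  have hle : ∀ n u, (∀ y, 0 ≤ ev y u) → ∫ y, χ n y * ev y u ∂μ ≤ L u := fun n u hu => by
    have := hg (-cutoff ev hcont (χ n) u) u fun y => by
      change 0 ≤ -(χ n y * ev y u) + ev y u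
      nlinarith [hu y, (hχ01 n y).2]
    rw [hsplit, ← neg_zero (G := A), ← Prod.neg_mk, map_neg, ← hcut] at this
    linarith
  have hposint : ∀ u, (∀ y, 0 ≤ ev y u) → Integrable (fun y => ev y u) μ := fun u hu => by
    refine ⟨(hcont u).measurable.aestronglyMeasurable, ?_⟩
    rw [hasFiniteIntegral_iff_ofReal (.of_forall hu)]
    refine lt_of_le_of_lt ?_ (ENNReal.ofReal_lt_top (r := L u))
    calc ∫⁻ y, ENNReal.ofReal (ev y u) ∂μ
        = ∫⁻ y, liminf (fun n => ENNReal.ofReal (χ n y * ev y u)) atTop ∂μ := by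
          refine lintegral_congr fun y => ?_
          refine (Tendsto.liminf_eq ?_).symm
          exact tendsto_const_nhds.congr' ((hev y u).mono fun n hn => by simp only [hn])
      _ ≤ liminf (fun n => ∫⁻ y, ENNReal.ofReal (χ n y * ev y u) ∂μ) atTop :=
          lintegral_liminf_le fun n =>
            ((χ n).continuous.mul (hcont u)).measurable.ennreal_ofReal
      _ ≤ ENNReal.ofReal (L u) := by
          refine (liminf_le_liminf (v := fun _ => ENNReal.ofReal (L u))
            (.of_forall fun n => ?_)).trans_eq (by simp)
          rw [← ofReal_integral_eq_lintegral_ofReal (hcutint n u)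
            (.of_forall fun y => mul_nonneg (hχ01 n y).1 (hu y))]
          exact ENNReal.ofReal_le_ofReal (hle n u hu)
  have hInt : ∀ v, Integrable (fun y => ev y v) μ := fun v => by
    refine (hposint (1 + v ^ 2) fun y => by simp only [map_add, map_one, map_pow]; positivity).mono'
      (hcont v).measurable.aestronglyMeasurable (.of_forall fun y => ?_)
    simp only [map_add, map_one, map_pow, Real.norm_eq_abs]
    nlinarith [sq_abs (ev y v), sq_nonneg (|ev y v| - 1)]
  refine ⟨μ, fun v => ⟨hInt v, ?_⟩⟩
  have ht1 : Tendsto (fun n => ∫ y, χ n y * ev y v ∂μ) atTop (𝓝 (∫ y, ev y v ∂μ)) := by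
    refine tendsto_integral_of_dominated_convergence (fun y => |ev y v|)
      (fun n => (hcutint n v).aestronglyMeasurable) (hInt v).abs
      (fun n => .of_forall fun y => ?_) (.of_forall fun y => tendsto_const_nhds.congr'
        ((hev y v).mono fun n hn => hn.symm))
    rw [Real.norm_eq_abs, abs_mul, abs_of_nonneg (hχ01 n y).1]
    exact mul_le_of_le_one_left (abs_nonneg _) (hχ01 n y).2
  have ht2 : Tendsto (fun n => ∫ y, χ n y * ev y v ∂μ) atTop (𝓝 (L v)) := by
    set W : A := (1 + v ^ 2) * w
    have hdom : ∀ ε : ℝ, 0 < ε → ∀ᶠ n in atTop, ∀ y, |ev y v - χ n y * ev y v| ≤ ε * ev y W := by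
      intro ε hε
      obtain ⟨K', hK', hK'w⟩ := hcoer (1 / ε)
      obtain ⟨N, hN⟩ := K.exists_superset_of_isCompact hK'
      filter_upwards [eventually_ge_atTop N] with n hn y
      have hWy : ev y W = (1 + ev y v ^ 2) * ev y w := by simp [W]
      by_cases hy : y ∈ K'
      · rw [hχ1 n y (K.subset hn (hN hy)), one_mul, sub_self, abs_zero, hWy]
        have := hw y
        positivity
      · have h1 := hK'w y hy
        rw [div_le_iff₀ hε] at h1
        rw [hWy, ← one_sub_mul, abs_mul, abs_of_nonneg (by linarith [(hχ01 n y).2])]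
        have h2 : (1 - χ n y) * |ev y v| ≤ |ev y v| :=
          mul_le_of_le_one_left (abs_nonneg _) (by linarith [(hχ01 n y).1])
        have h3 : |ev y v| ≤ 1 + ev y v ^ 2 := by
          nlinarith [sq_abs (ev y v), sq_nonneg (|ev y v| - 1)]
        have h4 := mul_le_mul_of_nonneg_left h1 (by positivity : 0 ≤ 1 + ev y v ^ 2)
        linarith
    have hLW : 0 ≤ L W := hL _ fun y => by
      simp only [W, map_mul, map_add, map_one, map_pow]
      have := hw y
      positivity
    rw [Metric.tendsto_nhds]
    intro δ hδ
    filter_upwards [hdom (δ / (L W + 1)) (by positivity)] with n hn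
    set ε := δ / (L W + 1)
    have hεW : ε * L W < δ := by
      rw [div_mul_eq_mul_div, div_lt_iff₀ (by positivity)]
      nlinarith
    have h1 := hg (-cutoff ev hcont (χ n) v) (v + ε • W) fun y => by
      change 0 ≤ -(χ n y * ev y v) + ev y (v + ε • W)
      rw [map_add, map_smul, smul_eq_mul]
      linarith [neg_le_of_abs_le (hn y)]
    have h2 := hg (cutoff ev hcont (χ n) v) (-v + ε • W) fun y => by
      change 0 ≤ (χ n y * ev y v) + ev y (-v + ε • W)
      rw [map_add, map_smul, smul_eq_mul, map_neg]
      linarith [le_of_abs_le (hn y)]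
    rw [hsplit, ← neg_zero (G := A), ← Prod.neg_mk, map_neg, ← hcut, map_add, map_smul,
      smul_eq_mul] at h1
    rw [hsplit, ← hcut, map_add, map_smul, smul_eq_mul, map_neg] at h2
    rw [Real.dist_eq, abs_lt]
    constructor <;> linarith
  exact tendsto_nhds_unique ht1 ht2

end Haviland

open Polynomial in
/-- A real polynomial in one variable which is nonnegative on the line is a sum of two squares. -/
theorem exists_eq_sq_add_sq_of_nonneg (p : ℝ[X]) (hp : ∀ x, 0 ≤ p.eval x) :
    ∃ a b : ℝ[X], p = a ^ 2 + b ^ 2 := by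
  induction hn : p.natDegree using Nat.strong_induction_on generalizing p with
  | _ n ih =>
  by_cases hdeg : p.natDegree = 0
  · obtain ⟨c, rfl⟩ := natDegree_eq_zero.1 hdeg
    have hc : 0 ≤ c := by simpa using hp 0
    exact ⟨C √c, 0, by rw [← C_pow, Real.sq_sqrt hc]; simp⟩
  obtain ⟨z, hz⟩ := IsAlgClosed.exists_aeval_eq_zero ℂ p
    (fun h => hdeg (natDegree_eq_of_degree_eq_some h))
  have hp0 : p ≠ 0 := fun h => hdeg (by simp [h])
  by_cases him : z.im = 0
  · have hroot : p.IsRoot z.re := by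
      have h1 : z = algebraMap ℝ ℂ z.re := by
        apply Complex.ext <;> simp [him]
      rw [h1, aeval_algebraMap_apply] at hz
      simpa using hz
    set r := z.re
    obtain ⟨q, hq⟩ := dvd_iff_isRoot.2 hroot
    have hqr : q.IsRoot r := by
      have hmul : ∀ x, 0 ≤ (x - r) * q.eval x := fun x => by simpa [hq] using hp x
      refine le_antisymm ?_ ?_
      · have h : ∀ᶠ x in 𝓝[<] r, q.eval x ≤ 0 := by
          filter_upwards [self_mem_nhdsWithin] with x hx
          have : x - r < 0 := sub_neg.2 hx
          nlinarith [hmul x]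
        exact le_of_tendsto (q.continuous.continuousWithinAt) h
      · have h : ∀ᶠ x in 𝓝[>] r, 0 ≤ q.eval x := by
          filter_upwards [self_mem_nhdsWithin] with x hx
          have : 0 < x - r := sub_pos.2 hx
          nlinarith [hmul x]
        exact ge_of_tendsto (q.continuous.continuousWithinAt) h
    obtain ⟨u, hu⟩ := dvd_iff_isRoot.2 hqr
    have hpu : p = (X - C r) ^ 2 * u := by rw [hq, hu]; ring
    have hmul : ∀ x, 0 ≤ (x - r) ^ 2 * u.eval x := fun x => by simpa [hpu] using hp x
    have hune : u ≠ 0 := by rintro rfl; simp at hpu; exact hp0 hpu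
    obtain ⟨a, b, hab⟩ := ih u.natDegree (by
      rw [← hn, hpu, natDegree_mul (pow_ne_zero _ (X_sub_C_ne_zero r)) hune]
      simp) u (fun x => by
        have h : ∀ᶠ y in 𝓝[≠] x, 0 ≤ u.eval y := by
          have h2 : ∀ᶠ y in 𝓝[≠] x, y ≠ r := by
            by_cases hxr : x = r
            · rw [hxr]; exact self_mem_nhdsWithin
            · exact nhdsWithin_le_nhds (isOpen_ne.mem_nhds hxr)
          filter_upwards [h2] with y hy
          have : 0 < (y - r) ^ 2 := by have := sub_ne_zero.2 hy; positivity
          nlinarith [hmul y]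
        exact ge_of_tendsto (u.continuous.continuousWithinAt) h) rfl
    exact ⟨(X - C r) * a, (X - C r) * b, by rw [hpu, hab]; ring⟩
  · obtain ⟨u, hu⟩ := p.quadratic_dvd_of_aeval_eq_zero_im_ne_zero hz him
    have hg : (X ^ 2 - C (2 * z.re) * X + C (‖z‖ ^ 2) : ℝ[X]) = (X - C z.re) ^ 2 + C z.im ^ 2 := by
      rw [← Complex.normSq_eq_norm_sq, Complex.normSq_apply]
      simp only [map_mul, map_add, C_ofNat]
      ring
    rw [hg] at hu
    have hgpos : ∀ x, 0 < (x - z.re) ^ 2 + z.im ^ 2 := fun x => by positivity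
    have hune : u ≠ 0 := by rintro rfl; simp at hu; exact hp0 hu
    have hgne : ((X - C z.re) ^ 2 + C z.im ^ 2 : ℝ[X]) ≠ 0 := fun h => by
      have := hgpos 0
      have h2 := congrArg (eval 0) h
      simp at h2 this
      linarith
    have hgdeg : ((X - C z.re) ^ 2 + C z.im ^ 2 : ℝ[X]).natDegree = 2 := by
      rw [← C_pow, natDegree_add_C]; simp
    obtain ⟨a, b, hab⟩ := ih u.natDegree (by
      rw [← hn, hu, natDegree_mul hgne hune, hgdeg]; omega) u (fun x => by
        have h := hp x
        rw [hu] at h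
        simp only [eval_mul, eval_add, eval_pow, eval_sub, eval_X, eval_C] at h
        exact nonneg_of_mul_nonneg_right h (hgpos x)) rfl
    exact ⟨(X - C z.re) * a + C z.im * b, (X - C z.re) * b - C z.im * a, by rw [hu, hab]; ring⟩

theorem integral_comp_simpleFunc {α : Type*} [MeasurableSpace α] (μ : Measure α)
    [IsFiniteMeasure μ] (f : SimpleFunc α ℝ) (g : ℝ → ℝ) :
    ∫ x, g (f x) ∂μ = ∑ y ∈ f.range, g y * μ.real (f ⁻¹' {y}) := by
  have h : ∀ x, g (f x) = ∑ y ∈ f.range, (f ⁻¹' {y}).indicator (fun _ => g y) x := fun x => by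
    rw [Finset.sum_eq_single (f x)]
    · simp
    · intro y _ hy
      exact indicator_of_notMem (fun h => hy h.symm) _
    · intro h
      exact absurd (f.mem_range_self x) h
  simp_rw [h]
  rw [integral_finsetSum _ fun y _ => (integrable_const _).indicator (f.measurableSet_fiber y)]
  refine Finset.sum_congr rfl fun y _ => ?_
  rw [integral_indicator_const _ (f.measurableSet_fiber y), smul_eq_mul, mul_comm]

/-- Simple functions approximating the identity of the line. -/
noncomputable def idApprox (n : ℕ) : SimpleFunc ℝ ℝ :=
  SimpleFunc.approxOn (fun x : ℝ => x) measurable_id univ 0 (mem_univ _) n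

theorem Tame.tendsto_integral_idApprox {m : ℕ → ℝ} {ν : Measure ℝ} (h : Tame m ν) (k : ℕ) :
    Tendsto (fun n => ∑ y ∈ (idApprox n).range, y ^ k * ν.real (idApprox n ⁻¹' {y})) atTop
      (𝓝 (∫ x : ℝ, x ^ k ∂ν)) := by
  have := h.finite
  simp_rw [← integral_comp_simpleFunc ν (idApprox _) (fun y => y ^ k)]
  refine tendsto_integral_of_dominated_convergence (fun x => 2 ^ k * |x ^ k|)
    (fun n => ((idApprox n).measurable.pow_const k).aestronglyMeasurable)
    ((h.integrable k).abs.const_mul _) (fun n => .of_forall fun x => ?_) (.of_forall fun x => ?_)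
  · have h2 := SimpleFunc.norm_approxOn_zero_le (f := fun x : ℝ => x) (s := univ) measurable_id
      (mem_univ _) x n
    rw [Real.norm_eq_abs, abs_pow, abs_pow, ← mul_pow]
    refine pow_le_pow_left₀ (abs_nonneg _) ?_ _
    rw [Real.norm_eq_abs] at h2
    simp only [idApprox]
    rw [Real.norm_eq_abs] at h2
    linarith
  · exact (SimpleFunc.tendsto_approxOn (f := fun x : ℝ => x) (s := univ) measurable_id
      (mem_univ _) (by simp)).pow k

section Functionals

open MvPolynomial

variable {d : ℕ} {m : Fin d → ℕ → ℝ} {ℓ : MvPolynomial (Fin d) ℝ →ₗ[ℝ] ℝ}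

/-- A functional on polynomials which is nonnegative on squares and whose even moments in each
direction, also after multiplication by a square, are controlled by `m`. -/
structure TamePos (m : Fin d → ℕ → ℝ) (ℓ : MvPolynomial (Fin d) ℝ →ₗ[ℝ] ℝ) : Prop where
  nonneg : ∀ p, 0 ≤ ℓ (p ^ 2)
  bound : ∀ p i, ∃ C, ∀ k : ℕ, ℓ (p ^ 2 * X i ^ (2 * k)) ≤ C * m i (2 * k)

theorem TamePos.exists_measure (h : TamePos m ℓ) (i : Fin d) (p : MvPolynomial (Fin d) ℝ) :
    ∃ ν : Measure ℝ, Tame (m i) ν ∧ ∀ n : ℕ, ∫ x : ℝ, x ^ n ∂ν = ℓ (p ^ 2 * X i ^ n) := by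
  obtain ⟨ν, hν⟩ := exists_measure_of_nonneg (Y := ℝ) (A := Polynomial ℝ)
    (fun y => Polynomial.aeval y) (fun v => Polynomial.continuous_aeval v) (Polynomial.X ^ 2)
    (fun y => by simp; positivity)
    (fun R => ⟨Icc (-(1 + |R|)) (1 + |R|), isCompact_Icc, fun y hy => by
      simp only [map_pow, Polynomial.aeval_X]
      rw [mem_Icc, ← abs_le, not_le] at hy
      nlinarith [sq_abs y, le_abs_self R, abs_nonneg R]⟩)
    (ℓ ∘ₗ LinearMap.mulLeft ℝ (p ^ 2) ∘ₗ (Polynomial.aeval (X i)).toLinearMap)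
    (fun v hv => by
      obtain ⟨a, b, rfl⟩ := exists_eq_sq_add_sq_of_nonneg v (by simpa using hv)
      simp only [LinearMap.comp_apply, AlgHom.toLinearMap_apply, map_add, map_pow,
        LinearMap.mulLeft_apply, ← mul_pow]
      exact add_nonneg (h.nonneg _) (h.nonneg _))
  have hInt : ∀ n : ℕ, Integrable (fun x : ℝ => x ^ n) ν := fun n => by
    simpa using (hν (Polynomial.X ^ n)).1
  have hmom : ∀ n : ℕ, ∫ x : ℝ, x ^ n ∂ν = ℓ (p ^ 2 * X i ^ n) := fun n => by
    simpa using (hν (Polynomial.X ^ n)).2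
  have hfin : IsFiniteMeasure ν := by
    have := hInt 0
    simp only [pow_zero] at this
    exact (integrable_const_iff_isFiniteMeasure one_ne_zero).1 this
  refine ⟨ν, ⟨hfin, hInt, ?_⟩, hmom⟩
  obtain ⟨C, hC⟩ := h.bound p i
  exact ⟨C, fun k => by rw [hmom]; exact hC k⟩

/-- A functional which is additive and positively homogeneous, bundled as a linear map. -/
def linearOfNonneg {E : Type*} [AddCommGroup E] [Module ℝ E] (f : E → ℝ)
    (hadd : ∀ x y, f (x + y) = f x + f y) (hsmul : ∀ (c : NNReal) x, f ((c : ℝ) • x) = c * f x) :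
    E →ₗ[ℝ] ℝ where
  toFun := f
  map_add' := hadd
  map_smul' c x := by
    have hneg : ∀ x, f (-x) = -f x := fun x => by
      have h0 : f 0 = 0 := by simpa using hadd 0 0
      have := hadd x (-x)
      rw [add_neg_cancel, h0] at this
      linarith
    rcases le_total 0 c with hc | hc
    · exact hsmul ⟨c, hc⟩ x
    · have := hsmul ⟨-c, neg_nonneg.2 hc⟩ x
      change f (-c • x) = -c * f x at this
      rw [neg_smul, hneg] at this
      rw [RingHom.id_apply, smul_eq_mul]
      linarith

theorem real_eq_of_sq_add_eq (hm : ∀ i, QAWeight (m i)) {i : Fin d}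
    {ν : MvPolynomial (Fin d) ℝ → Measure ℝ} (hν : ∀ p, Tame (m i) (ν p))
    (hmom : ∀ p (n : ℕ), ∫ x : ℝ, x ^ n ∂(ν p) = ℓ (p ^ 2 * X i ^ n)) (c : NNReal)
    {p₁ p₂ p₃ q₁ q₂ q₃ : MvPolynomial (Fin d) ℝ}
    (h : p₁ ^ 2 + (c : ℝ) • p₂ ^ 2 + p₃ ^ 2 = q₁ ^ 2 + (c : ℝ) • q₂ ^ 2 + q₃ ^ 2) (E : Set ℝ) :
    (ν p₁).real E + c * (ν p₂).real E + (ν p₃).real E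
      = (ν q₁).real E + c * (ν q₂).real E + (ν q₃).real E := by
  have hfin : ∀ p, IsFiniteMeasure (ν p) := fun p => (hν p).finite
  have ht : ∀ p₁ p₂ p₃, Tame (m i) (ν p₁ + c • ν p₂ + ν p₃) := fun p₁ p₂ p₃ =>
    ((hν p₁).add ((hν p₂).smul c)).add (hν p₃)
  have hi : ∀ p₁ p₂ p₃ (n : ℕ), ∫ x : ℝ, x ^ n ∂(ν p₁ + c • ν p₂ + ν p₃)
      = ℓ ((p₁ ^ 2 + (c : ℝ) • p₂ ^ 2 + p₃ ^ 2) * X i ^ n) := fun p₁ p₂ p₃ n => by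
    rw [integral_add_measure (((hν p₁).add ((hν p₂).smul c)).integrable n) ((hν p₃).integrable n),
      integral_add_measure ((hν p₁).integrable n) (((hν p₂).smul c).integrable n),
      integral_smul_nnreal_measure, hmom, hmom, hmom, add_mul, add_mul, map_add, map_add,
      smul_mul_assoc, map_smul]
    rfl
  have hmeas : ν p₁ + c • ν p₂ + ν p₃ = ν q₁ + c • ν q₂ + ν q₃ :=
    Tame.ext (hm i) (ht _ _ _) (ht _ _ _) fun n => by rw [hi, hi, h]
  have hr : ∀ p₁ p₂ p₃, (ν p₁ + c • ν p₂ + ν p₃).real E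
      = (ν p₁).real E + c * (ν p₂).real E + (ν p₃).real E := fun p₁ p₂ p₃ => by
    rw [measureReal_add_apply, measureReal_add_apply, measureReal_nnreal_smul_apply]
  rw [← hr, ← hr, hmeas]

theorem C_inv_two_sq_mul_four : (C (2⁻¹ : ℝ) : MvPolynomial (Fin d) ℝ) ^ 2 * 4 = 1 := by
  rw [← map_ofNat C 4, ← C_pow, ← C_mul]
  norm_num

/-- Restricting the spectral measures of a functional in the `i`-th direction to a Borel set. -/
theorem TamePos.exists_slice (hm : ∀ i, QAWeight (m i)) (h : TamePos m ℓ) (i : Fin d) :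
    ∃ φ : Set ℝ → MvPolynomial (Fin d) ℝ →ₗ[ℝ] ℝ, (∀ E, TamePos m (φ E)) ∧
      ∀ c, ∃ ν₁ ν₂ : Measure ℝ, Tame (m i) ν₁ ∧ Tame (m i) ν₂ ∧
        (∀ n : ℕ, ∫ x : ℝ, x ^ n ∂ν₁ - ∫ x : ℝ, x ^ n ∂ν₂ = ℓ (c * X i ^ n)) ∧
        ∀ E, φ E c = ν₁.real E - ν₂.real E := by
  choose ν hν hmom using fun p => h.exists_measure i p
  have hfin : ∀ p, IsFiniteMeasure (ν p) := fun p => (hν p).finite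
  let f : Set ℝ → MvPolynomial (Fin d) ℝ → ℝ := fun E c =>
    (ν (C 2⁻¹ * (c + 1))).real E - (ν (C 2⁻¹ * (c - 1))).real E
  have hadd : ∀ E p q, f E (p + q) = f E p + f E q := fun E p q => by
    have := real_eq_of_sq_add_eq hm hν hmom 1 (p₁ := C 2⁻¹ * (p + q + 1)) (p₂ := C 2⁻¹ * (p - 1))
      (p₃ := C 2⁻¹ * (q - 1)) (q₁ := C 2⁻¹ * (p + q - 1)) (q₂ := C 2⁻¹ * (p + 1))
      (q₃ := C 2⁻¹ * (q + 1)) (by rw [NNReal.coe_one, one_smul, one_smul]; ring) E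
    rw [NNReal.coe_one] at this
    simp only [f]
    linarith
  have hsmul : ∀ E (c : NNReal) p, f E ((c : ℝ) • p) = c * f E p := fun E c p => by
    have := real_eq_of_sq_add_eq hm hν hmom c (p₁ := C 2⁻¹ * ((c : ℝ) • p + 1))
      (p₂ := C 2⁻¹ * (p - 1)) (p₃ := 0) (q₁ := C 2⁻¹ * ((c : ℝ) • p - 1))
      (q₂ := C 2⁻¹ * (p + 1)) (q₃ := 0) (by simp only [MvPolynomial.smul_eq_C_mul]; ring) E
    simp only [f]
    linarith
  have hsq : ∀ E p, f E (p ^ 2) = (ν p).real E := fun E p => by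
    have := real_eq_of_sq_add_eq hm hν hmom 1 (p₁ := C 2⁻¹ * (p ^ 2 + 1)) (p₂ := 0) (p₃ := 0)
      (q₁ := C 2⁻¹ * (p ^ 2 - 1)) (q₂ := p) (q₃ := 0) (by
        rw [NNReal.coe_one, one_smul, one_smul]
        linear_combination p ^ 2 * C_inv_two_sq_mul_four) E
    have h0 : (ν 0).real E = 0 := by
      have h1 : (ν 0).real univ = 0 := by simpa using hmom 0 0
      exact le_antisymm (h1 ▸ measureReal_mono (subset_univ E)) measureReal_nonneg
    rw [NNReal.coe_one, h0] at this
    simp only [f]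
    linarith
  have hle : ∀ E p, f E (p ^ 2) ≤ ℓ (p ^ 2) := fun E p => by
    rw [hsq]
    have h1 : (ν p).real univ = ℓ (p ^ 2) := by simpa using hmom p 0
    exact h1 ▸ measureReal_mono (subset_univ E)
  refine ⟨fun E => linearOfNonneg (f E) (hadd E) (hsmul E), fun E => ⟨fun p => ?_, fun p j => ?_⟩,
    fun c => ⟨ν (C 2⁻¹ * (c + 1)), ν (C 2⁻¹ * (c - 1)), hν _, hν _, fun n => ?_,
      fun E => rfl⟩⟩
  · exact measureReal_nonneg.trans_eq (hsq E p).symm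
  · obtain ⟨C, hC⟩ := h.bound p j
    refine ⟨C, fun k => le_trans ?_ (hC k)⟩
    have := hle E (p * X j ^ k)
    rwa [mul_pow, ← pow_mul, mul_comm k] at this
  · rw [hmom, hmom, ← map_sub]
    congr 1
    linear_combination c * X i ^ n * C_inv_two_sq_mul_four

end Functionals

section Positivity

open MvPolynomial

variable {d : ℕ} {m : Fin d → ℕ → ℝ} {ℓ : MvPolynomial (Fin d) ℝ →ₗ[ℝ] ℝ}

/-- Keep the variables in `S` and evaluate the others at `t`. -/
noncomputable def partialEval (S : Finset (Fin d)) (t : Fin d → ℝ) :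
    MvPolynomial (Fin d) ℝ →ₐ[ℝ] MvPolynomial (Fin d) ℝ :=
  aeval fun i => if i ∈ S then X i else C (t i)

theorem tendsto_sum_slice {i : Fin d} {φ : Set ℝ → MvPolynomial (Fin d) ℝ →ₗ[ℝ] ℝ}
    (hφ : ∀ c, ∃ ν₁ ν₂ : Measure ℝ, Tame (m i) ν₁ ∧ Tame (m i) ν₂ ∧
        (∀ n : ℕ, ∫ x : ℝ, x ^ n ∂ν₁ - ∫ x : ℝ, x ^ n ∂ν₂ = ℓ (c * X i ^ n)) ∧
        ∀ E, φ E c = ν₁.real E - ν₂.real E)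
    {S : Finset (Fin d)} (hi : i ∉ S) (t : Fin d → ℝ) (r c : MvPolynomial (Fin d) ℝ) (k : ℕ) :
    Tendsto (fun n => ∑ y ∈ (idApprox n).range,
        y ^ k * φ (idApprox n ⁻¹' {y}) (c * partialEval S (Function.update t i y) r)) atTop
      (𝓝 (ℓ (c * partialEval (insert i S) t r * X i ^ k))) := by
  induction r using MvPolynomial.induction_on generalizing c k with
  | C a =>
    obtain ⟨ν₁, ν₂, h₁, h₂, hmom, hE⟩ := hφ (c * C a)
    simp only [partialEval, aeval_C, MvPolynomial.algebraMap_eq, hE, mul_sub,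
      Finset.sum_sub_distrib, ← hmom]
    exact (h₁.tendsto_integral_idApprox k).sub (h₂.tendsto_integral_idApprox k)
  | add p q hp hq =>
    simpa only [map_add, mul_add, add_mul, Finset.sum_add_distrib] using (hp c k).add (hq c k)
  | mul_X p j hp =>
    have hX : ∀ S (t : Fin d → ℝ), partialEval S t (X j) = if j ∈ S then X j else C (t j) :=
      fun S t => by simp [partialEval]
    simp only [map_mul, hX]
    by_cases hji : j = i
    · subst hji
      simp only [hi, if_false, Finset.mem_insert_self, if_true, Function.update_self]
      have hc : c * (partialEval (insert j S) t p * X j) * X j ^ k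
          = c * partialEval (insert j S) t p * X j ^ (k + 1) := by ring
      rw [hc]
      refine (hp c (k + 1)).congr fun n => Finset.sum_congr rfl fun y _ => ?_
      rw [mul_comm _ (C y), ← MvPolynomial.smul_eq_C_mul, mul_smul_comm, map_smul, smul_eq_mul]
      ring
    · have h1 : ∀ y, Function.update t i y j = t j := fun y => Function.update_of_ne hji _ _
      simp only [Finset.mem_insert, hji, false_or, h1]
      set e : MvPolynomial (Fin d) ℝ := if j ∈ S then X j else C (t j)
      have hc : c * (partialEval (insert i S) t p * e) * X i ^ k
          = c * e * partialEval (insert i S) t p * X i ^ k := by ring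
      rw [hc]
      refine (hp (c * e) k).congr fun n => Finset.sum_congr rfl fun y _ => ?_
      rw [mul_right_comm, mul_assoc c]

theorem TamePos.partialEval_nonneg (hm : ∀ i, QAWeight (m i)) (S : Finset (Fin d))
    (h : TamePos m ℓ) (t : Fin d → ℝ) (r : MvPolynomial (Fin d) ℝ) (hr : ∀ x, 0 ≤ eval x r) :
    0 ≤ ℓ (partialEval S t r) := by
  induction S using Finset.induction_on generalizing ℓ t with
  | empty =>
    have h1 : partialEval ∅ t r = C (eval t r) := by
      have : partialEval (d := d) ∅ t = (Algebra.ofId ℝ _).comp (aeval t) := by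
        ext j
        simp [partialEval, Algebra.ofId_apply]
      rw [this]
      simp [Algebra.ofId_apply, aeval_eq_eval]
    rw [h1, ← mul_one (C _), ← MvPolynomial.smul_eq_C_mul, map_smul, smul_eq_mul]
    exact mul_nonneg (hr t) (by simpa using h.nonneg 1)
  | insert i S hi ih =>
    obtain ⟨φ, hφ, hν⟩ := h.exists_slice hm i
    have := tendsto_sum_slice hν hi t r 1 0
    simp only [one_mul, pow_zero, mul_one] at this
    exact ge_of_tendsto' this fun n => Finset.sum_nonneg fun y _ => ih (hφ _) _

theorem TamePos.nonneg_of_eval_nonneg (hm : ∀ i, QAWeight (m i)) (h : TamePos m ℓ)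
    (r : MvPolynomial (Fin d) ℝ) (hr : ∀ x, 0 ≤ eval x r) : 0 ≤ ℓ r := by
  have h1 : partialEval Finset.univ 0 r = r := by simp [partialEval]
  exact h1 ▸ h.partialEval_nonneg hm Finset.univ 0 r hr

theorem TamePos.exists_mvTame (hm : ∀ i, QAWeight (m i)) (h : TamePos m ℓ) :
    ∃ μ : Measure (Fin d → ℝ), MvTame m μ ∧ ∀ p, ∫ x, eval x p ∂μ = ℓ p := by
  have hae : ∀ (x : Fin d → ℝ) (p : MvPolynomial (Fin d) ℝ), aeval x p = eval x p := fun x p => by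
    rw [aeval_eq_eval]
  obtain ⟨μ, hμ⟩ := exists_measure_of_nonneg (Y := Fin d → ℝ) (A := MvPolynomial (Fin d) ℝ)
    (fun x => aeval x) (fun p => by simpa only [hae] using p.continuous_eval)
    (∑ i, X i ^ 2) (fun x => by
      simp only [map_sum, map_pow, aeval_X]
      positivity)
    (fun R => ⟨Icc (fun _ => -(1 + |R|)) (fun _ => 1 + |R|), isCompact_Icc, fun x hx => by
      simp only [map_sum, map_pow, aeval_X]
      have hx2 : ∃ i, 1 + |R| < |x i| := by
        by_contra! hcon
        exact hx ⟨fun i => (abs_le.1 (hcon i)).1, fun i => (abs_le.1 (hcon i)).2⟩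
      obtain ⟨i, hi⟩ := hx2
      have h1 : x i ^ 2 ≤ ∑ i, x i ^ 2 :=
        Finset.single_le_sum (f := fun i => x i ^ 2) (fun j _ => sq_nonneg _) (Finset.mem_univ i)
      nlinarith [sq_abs (x i), le_abs_self R, abs_nonneg R]⟩) ℓ
    (fun r hr => h.nonneg_of_eval_nonneg hm r (by simpa only [hae] using hr))
  simp only [hae] at hμ
  have hfin : IsFiniteMeasure μ := by
    have := (hμ 1).1
    simp only [map_one] at this
    exact (integrable_const_iff_isFiniteMeasure one_ne_zero).1 this
  refine ⟨μ, ⟨hfin, fun p => (hμ p).1, fun p i => ?_⟩, fun p => (hμ p).2⟩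
  obtain ⟨C, hC⟩ := h.bound p i
  exact ⟨C, fun k => by rw [(hμ _).2]; exact hC k⟩

end Positivity

section Support

open MvPolynomial

variable {d : ℕ} {m : Fin d → ℕ → ℝ} {ℓ : MvPolynomial (Fin d) ℝ →ₗ[ℝ] ℝ}

theorem MvTame.add {μ₁ μ₂ : Measure (Fin d → ℝ)} (h₁ : MvTame m μ₁) (h₂ : MvTame m μ₂) :
    MvTame m (μ₁ + μ₂) := by
  have := h₁.finite
  have := h₂.finite
  refine ⟨inferInstance, fun p => (h₁.integrable p).add_measure (h₂.integrable p), fun p i => ?_⟩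
  obtain ⟨C₁, hC₁⟩ := h₁.bound p i
  obtain ⟨C₂, hC₂⟩ := h₂.bound p i
  refine ⟨C₁ + C₂, fun k => ?_⟩
  rw [integral_add_measure (h₁.integrable _) (h₂.integrable _)]
  linarith [hC₁ k, hC₂ k]

theorem integral_withDensity_eval (μ : Measure (Fin d → ℝ)) (p q : MvPolynomial (Fin d) ℝ) :
    ∫ x, eval x p ∂(μ.withDensity fun x => ENNReal.ofReal (eval x q))
      = ∫ x, max (eval x q) 0 * eval x p ∂μ := by
  rw [integral_withDensity_eq_integral_toReal_smul
    q.continuous_eval.measurable.ennreal_ofReal (.of_forall fun x => ENNReal.ofReal_lt_top)]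
  simp [ENNReal.toReal_ofReal']

theorem MvTame.integrable_max_mul {μ : Measure (Fin d → ℝ)} (h : MvTame m μ)
    (p q : MvPolynomial (Fin d) ℝ) : Integrable (fun x => max (eval x q) 0 * eval x p) μ := by
  refine (h.integrable (q * p)).mono (((q.continuous_eval.max continuous_const).mul
    p.continuous_eval).measurable.aestronglyMeasurable) (.of_forall fun x => ?_)
  rw [map_mul, norm_mul, norm_mul]
  refine mul_le_mul_of_nonneg_right ?_ (norm_nonneg _)
  rw [Real.norm_eq_abs, Real.norm_eq_abs, abs_of_nonneg (le_max_right _ _)]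
  exact max_le (le_abs_self _) (abs_nonneg _)

theorem MvTame.withDensity {μ : Measure (Fin d → ℝ)} (h : MvTame m μ)
    (q : MvPolynomial (Fin d) ℝ) :
    MvTame m (μ.withDensity fun x => ENNReal.ofReal (eval x q)) := by
  refine ⟨isFiniteMeasure_withDensity_ofReal (h.integrable q).2, fun p => ?_, fun p i => ?_⟩
  · rw [integrable_withDensity_iff_integrable_smul' q.continuous_eval.measurable.ennreal_ofReal
      (.of_forall fun x => ENNReal.ofReal_lt_top)]
    simpa [ENNReal.toReal_ofReal'] using h.integrable_max_mul p q
  · obtain ⟨C₁, hC₁⟩ := h.bound p i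
    obtain ⟨C₂, hC₂⟩ := h.bound (q * p) i
    refine ⟨C₁ + C₂, fun k => ?_⟩
    rw [integral_withDensity_eval]
    have h1 : ∫ x, max (eval x q) 0 * eval x (p ^ 2 * X i ^ (2 * k)) ∂μ
        ≤ ∫ x, (eval x (p ^ 2 * X i ^ (2 * k)) + eval x ((q * p) ^ 2 * X i ^ (2 * k))) ∂μ := by
      refine integral_mono (h.integrable_max_mul _ q) ((h.integrable _).add (h.integrable _))
        fun x => ?_
      have h2 : max (eval x q) 0 ≤ 1 + eval x q ^ 2 :=
        max_le (by nlinarith [sq_nonneg (eval x q - 1)]) (by positivity)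
      have h3 : 0 ≤ eval x p ^ 2 * x i ^ (2 * k) := by rw [pow_mul]; positivity
      have := mul_le_mul_of_nonneg_right h2 h3
      simp only [map_mul, map_pow, eval_X]
      linarith
    rw [integral_add (h.integrable _) (h.integrable _)] at h1
    linarith [hC₁ k, hC₂ k]

theorem MvTame.measure_neg_eq_zero (hm : ∀ i, QAWeight (m i)) {μ : Measure (Fin d → ℝ)}
    (h : MvTame m μ) {q : MvPolynomial (Fin d) ℝ} {ℓ : MvPolynomial (Fin d) ℝ →ₗ[ℝ] ℝ}
    (hℓ : TamePos m ℓ) (hq : ∀ p, ℓ p = ∫ x, eval x (q * p) ∂μ) : μ {x | eval x q < 0} = 0 := by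
  obtain ⟨μ', hμ', hmom⟩ := hℓ.exists_mvTame hm
  have hEq : μ' + μ.withDensity (fun x => ENNReal.ofReal (eval x (-q)))
      = μ.withDensity fun x => ENNReal.ofReal (eval x q) := by
    refine MvTame.ext hm (hμ'.add (h.withDensity _)) (h.withDensity q) fun p => ?_
    rw [integral_add_measure (hμ'.integrable _) ((h.withDensity _).integrable _),
      integral_withDensity_eval, integral_withDensity_eval, hmom, hq,
      ← integral_add (h.integrable _) (h.integrable_max_mul _ _)]
    refine integral_congr_ae (.of_forall fun x => ?_)
    simp only [map_mul, map_neg]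
    rw [← add_mul]
    congr 1
    rcases le_total (eval x q) 0 with h | h
    · rw [max_eq_left (by linarith), max_eq_right h]; ring
    · rw [max_eq_right (by linarith), max_eq_left h]; ring
  have hB : MeasurableSet {x | eval x q < 0} :=
    measurableSet_lt q.continuous_eval.measurable measurable_const
  have h1 : (μ.withDensity fun x => ENNReal.ofReal (eval x q)) {x | eval x q < 0} = 0 := by
    rw [withDensity_apply_eq_zero q.continuous_eval.measurable.ennreal_ofReal]
    convert measure_empty (μ := μ)
    ext x
    simp only [mem_inter_iff, mem_ofPred_eq, mem_empty_iff_false, iff_false, not_and, not_lt, ne_eq,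
      ENNReal.ofReal_eq_zero, not_le]
    exact le_of_lt
  rw [← hEq, Measure.add_apply, add_eq_zero] at h1
  have h2 := h1.2
  rw [withDensity_apply_eq_zero (-q).continuous_eval.measurable.ennreal_ofReal] at h2
  convert h2 using 2
  ext x
  simp

/-- Existence of a representing measure supported where all elements of `T` are nonnegative. -/
theorem TamePos.exists_mvTame_support (hm : ∀ i, QAWeight (m i)) (h : TamePos m ℓ)
    (T : Set (MvPolynomial (Fin d) ℝ)) (hT : ∀ q ∈ T, TamePos m (ℓ ∘ₗ LinearMap.mulLeft ℝ q)) :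
    ∃ μ : Measure (Fin d → ℝ), MvTame m μ ∧ (∀ p, ∫ x, eval x p ∂μ = ℓ p) ∧
      μ {x | ∀ q ∈ T, 0 ≤ eval x q}ᶜ = 0 := by
  obtain ⟨μ, hμ, hmom⟩ := h.exists_mvTame hm
  refine ⟨μ, hμ, hmom, ?_⟩
  have h1 : {x | ∀ q ∈ T, 0 ≤ eval x q}ᶜ = ⋃ q ∈ T, {x | eval x q < 0} := by
    ext x
    simp
  obtain ⟨T', hT'T, hT'c, hT'⟩ := TopologicalSpace.isOpen_biUnion_countable T
    (fun q : MvPolynomial (Fin d) ℝ => {x : Fin d → ℝ | eval x q < 0})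
    (fun q _ => isOpen_lt q.continuous_eval continuous_const)
  rw [h1, ← hT', measure_biUnion_null_iff hT'c]
  exact fun q hq => hμ.measure_neg_eq_zero hm (hT q (hT'T hq)) fun p => (hmom (q * p)).symm

end Support

section Algebra

variable {A : Type*} [CommRing A] [Algebra ℝ A]

/-- The Cauchy–Schwarz inequality. -/
theorem sq_le_mul_of_nonneg_sq {L : A →ₗ[ℝ] ℝ} (hL : ∀ x, 0 ≤ L (x ^ 2)) (x y : A) :
    L (x * y) ^ 2 ≤ L (x ^ 2) * L (y ^ 2) := by
  have h : ∀ t : ℝ, 0 ≤ L (y ^ 2) * (t * t) + 2 * L (x * y) * t + L (x ^ 2) := fun t => by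
    have h1 := hL (x + t • y)
    have h2 : (x + t • y) ^ 2 = (t * t) • y ^ 2 + (2 * t) • (x * y) + x ^ 2 := by
      simp only [Algebra.smul_def, map_mul, map_ofNat]
      ring
    rw [h2, map_add, map_add, map_smul, map_smul, smul_eq_mul, smul_eq_mul] at h1
    linarith
  have := discrim_le_zero h
  rw [discrim] at this
  nlinarith

theorem le_sqrt_mul_sqrt_of_nonneg_sq {L : A →ₗ[ℝ] ℝ} (hL : ∀ x, 0 ≤ L (x ^ 2)) (x y : A) :
    L (x * y) ≤ √(L (x ^ 2)) * √(L (y ^ 2)) := by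
  rw [← Real.sqrt_mul (hL x)]
  exact Real.le_sqrt_of_sq_le (sq_le_mul_of_nonneg_sq hL x y)

theorem qaWeight_sqrt {L : A →ₗ[ℝ] ℝ} (hL : ∀ x, 0 ≤ L (x ^ 2)) (hL1 : L 1 = 1) {b : A}
    (hqa : IsQuasiAnalytic (fun n : ℕ => √(L (b ^ (2 * n))))) :
    QAWeight (fun n : ℕ => √(L (b ^ (2 * n)))) := by
  have hs : ∀ n : ℕ, 0 ≤ L (b ^ (2 * n)) := fun n => by
    rw [mul_comm, pow_mul]; exact hL _
  refine ⟨hqa, by simp [hL1], fun n => Real.sqrt_nonneg _, ?_⟩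
  have hcs : ∀ i j : ℕ, L (b ^ (i + j)) ^ 2 ≤ L (b ^ (2 * i)) * L (b ^ (2 * j)) := fun i j => by
    have := sq_le_mul_of_nonneg_sq hL (b ^ i) (b ^ j)
    rwa [← pow_add, ← pow_mul, ← pow_mul, mul_comm i, mul_comm j] at this
  rcases (hs 1).eq_or_lt with h0 | h0
  · left
    have := hcs 1 3
    rw [← h0, zero_mul] at this
    have h4 : L (b ^ (1 + 3)) = 0 := by nlinarith [sq_nonneg (L (b ^ (1 + 3)))]
    have h5 : L (b ^ (2 * 2)) = 0 := h4
    simp only [h5, Real.sqrt_zero]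
  · right
    refine ⟨√(L (b ^ (2 * 1))), Real.sqrt_pos.2 h0, fun n => ?_⟩
    rw [← Real.sqrt_mul h0.le]
    refine Real.sqrt_le_sqrt ?_
    have hpos : ∀ n : ℕ, 0 < L (b ^ (2 * n)) ∧
        L (b ^ (2 * 1)) * L (b ^ (2 * n)) ≤ L (b ^ (2 * (n + 1))) := fun n => by
      induction n with
      | zero => simp [hL1]
      | succ n ih =>
        have h1 := (mul_pos h0 ih.1).trans_le ih.2
        refine ⟨h1, ?_⟩
        have h2 := hcs n (n + 2)
        have h3 : n + (n + 2) = 2 * (n + 1) := by ring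
        rw [h3] at h2
        have h4 : L (b ^ (2 * n)) * (L (b ^ (2 * 1)) * L (b ^ (2 * (n + 1))))
            ≤ L (b ^ (2 * n)) * L (b ^ (2 * (n + 2))) := by
          nlinarith [mul_le_mul_of_nonneg_right ih.2 h1.le]
        exact le_of_mul_le_mul_left h4 ih.1
    exact (hpos n).2

open MvPolynomial in
theorem tamePos_mulLeft {d : ℕ} {L : A →ₗ[ℝ] ℝ} (hL : ∀ x, 0 ≤ L (x ^ 2)) (a : Fin d → A) {q : A}
    (hq : ∀ x, 0 ≤ L (q * x ^ 2)) :
    TamePos (fun i n => √(L (a i ^ (2 * n))))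
      (L ∘ₗ LinearMap.mulLeft ℝ q ∘ₗ (aeval a : MvPolynomial (Fin d) ℝ →ₐ[ℝ] A).toLinearMap) := by
  refine ⟨fun p => by simpa using hq (aeval a p), fun p i =>
    ⟨√(L ((q * aeval a p ^ 2) ^ 2)), fun k => ?_⟩⟩
  have := le_sqrt_mul_sqrt_of_nonneg_sq hL (q * aeval a p ^ 2) (a i ^ (2 * k))
  rw [← pow_mul (a i), mul_comm (2 * k) 2] at this
  simpa [mul_assoc] using this

end Algebra

section CharacterSpace

variable {A : Type*} [CommRing A] [Algebra ℝ A] {d : ℕ} (a : Fin d → A)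

/-- The point of `ℝᵈ` defined by a character. -/
def charPoint (α : A →ₐ[ℝ] ℝ) : Fin d → ℝ := fun i => α (a i)

open MvPolynomial in
theorem eval_charPoint (α : A →ₐ[ℝ] ℝ) (p : MvPolynomial (Fin d) ℝ) :
    eval (charPoint a α) p = α (aeval a p) := by
  have : (aeval (charPoint a α) : MvPolynomial (Fin d) ℝ →ₐ[ℝ] ℝ) = α.comp (aeval a) := by
    ext i
    simp [charPoint]
  rw [← aeval_eq_eval]
  exact DFunLike.congr_fun this p

variable {a}

open MvPolynomial in
theorem aeval_surjective_of_adjoin_eq_top (hgen : Algebra.adjoin ℝ (Set.range a) = ⊤) :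
    Function.Surjective (aeval a : MvPolynomial (Fin d) ℝ →ₐ[ℝ] A) := by
  rw [← AlgHom.range_eq_top, ← Algebra.adjoin_range_eq_range_aeval, hgen]

theorem continuous_char_apply (b : A) : Continuous fun α : A →ₐ[ℝ] ℝ => α b :=
  (continuous_apply b).comp continuous_induced_dom

open MvPolynomial in
theorem range_charPoint (hgen : Algebra.adjoin ℝ (Set.range a) = ⊤) :
    range (charPoint a) = {x | ∀ p : MvPolynomial (Fin d) ℝ, aeval a p = 0 → eval x p = 0} := by
  have hsurj := aeval_surjective_of_adjoin_eq_top hgen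
  ext x
  constructor
  · rintro ⟨α, rfl⟩ p hp
    rw [eval_charPoint, hp, map_zero]
  · intro hx
    have hker : RingHom.ker (aeval a : MvPolynomial (Fin d) ℝ →ₐ[ℝ] A).toRingHom
        ≤ RingHom.ker (aeval x : MvPolynomial (Fin d) ℝ →ₐ[ℝ] ℝ).toRingHom := fun p hp => by
      change aeval x p = 0
      rw [aeval_eq_eval]
      exact hx p hp
    refine ⟨AlgHom.liftOfSurjective (aeval a) hsurj (aeval x) hker, funext fun i => ?_⟩
    simpa [charPoint] using AlgHom.liftOfSurjective_apply (aeval a) hsurj (aeval x) hker (X i)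

open MvPolynomial in
theorem isClosedEmbedding_charPoint (hgen : Algebra.adjoin ℝ (Set.range a) = ⊤) :
    IsClosedEmbedding (charPoint a : (A →ₐ[ℝ] ℝ) → Fin d → ℝ) := by
  have hsurj := aeval_surjective_of_adjoin_eq_top hgen
  have hcont : Continuous (charPoint a : (A →ₐ[ℝ] ℝ) → Fin d → ℝ) :=
    continuous_pi fun i => continuous_char_apply (a i)
  refine ⟨⟨⟨le_antisymm hcont.le_induced ?_⟩, fun α β h => ?_⟩, ?_⟩
  · let τ : TopologicalSpace (A →ₐ[ℝ] ℝ) := TopologicalSpace.induced (charPoint a) inferInstance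
    refine (@continuous_iff_le_induced _ (A → ℝ) _ τ _).1
      (@continuous_pi _ _ _ τ _ _ fun b => ?_)
    obtain ⟨p, rfl⟩ := hsurj b
    simp_rw [← eval_charPoint]
    exact p.continuous_eval.comp continuous_induced_dom
  · refine AlgHom.ext_of_adjoin_eq_top hgen ?_
    rintro _ ⟨i, rfl⟩
    exact congrFun h i
  · rw [range_charPoint hgen]
    simp only [ofPred_forall]
    exact isClosed_iInter fun p => isClosed_iInter fun _ =>
      isClosed_eq p.continuous_eval continuous_const

open MvPolynomial in
theorem IsRepr.map_charPoint (hgen : Algebra.adjoin ℝ (Set.range a) = ⊤) {L : A →ₗ[ℝ] ℝ}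
    {K : Set (A →ₐ[ℝ] ℝ)} {ν : Measure (A →ₐ[ℝ] ℝ)} (hν : IsRepr L K ν) {m : Fin d → ℕ → ℝ}
    (hL : TamePos m (L ∘ₗ (aeval a : MvPolynomial (Fin d) ℝ →ₐ[ℝ] A).toLinearMap)) :
    MvTame m (ν.map (charPoint a)) ∧
      ∀ p : MvPolynomial (Fin d) ℝ, ∫ x, eval x p ∂(ν.map (charPoint a)) = L (aeval a p) := by
  have he := (isClosedEmbedding_charPoint hgen).measurableEmbedding
  have hInt : ∀ p : MvPolynomial (Fin d) ℝ, ∫ x, eval x p ∂(ν.map (charPoint a)) = L (aeval a p) :=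
    fun p => by
      rw [he.integral_map, (hν.2.2 _).2]
      simp only [eval_charPoint]
  have hfin : IsFiniteMeasure ν := by
    have := (hν.2.2 1).1
    simp only [map_one] at this
    exact (integrable_const_iff_isFiniteMeasure one_ne_zero).1 this
  refine ⟨⟨inferInstance, fun p => ?_, fun p i => ?_⟩, hInt⟩
  · rw [he.integrable_map_iff]
    simpa only [Function.comp_def, eval_charPoint] using (hν.2.2 (aeval a p)).1
  · obtain ⟨C, hC⟩ := hL.bound p i
    exact ⟨C, fun k => by rw [hInt]; exact hC k⟩

end CharacterSpace

end Moments

/-- Nussbaum-type theorem for a finitely generated algebra: if `L` is non-negative on a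
quadratic module `Q` and the classes `C{√(L(a_i^{2n}))}` are quasi-analytic for the
generators `a_1, …, a_d`, then `L` has a unique `K_Q`-representing Radon measure. -/
theorem nussbaum_finitely_generated
    (A : Type*) [CommRing A] [Algebra ℝ A] [Nonempty (A →ₐ[ℝ] ℝ)]
    (d : ℕ) (a : Fin d → A) (hgen : Algebra.adjoin ℝ (Set.range a) = (⊤ : Subalgebra ℝ A))
    (L : A →ₗ[ℝ] ℝ) (hL1 : L 1 = 1)
    (Q : Set A) (hQ : IsQuadraticModule Q)
    (hLQ : ∀ q ∈ Q, 0 ≤ L q)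
    (hqa : ∀ i : Fin d, IsQuasiAnalytic (fun n : ℕ => Real.sqrt (L (a i ^ (2 * n))))) :
    ∃! ν : Measure (A →ₐ[ℝ] ℝ),
      IsRepr L {α : A →ₐ[ℝ] ℝ | ∀ q ∈ Q, 0 ≤ α q} ν := by
  have hLq : ∀ q ∈ Q, ∀ x, 0 ≤ L (q * x ^ 2) := fun q hq x => by
    rw [mul_comm]
    exact hLQ _ (hQ.2.2 x q hq)
  have hL : ∀ x, 0 ≤ L (x ^ 2) := fun x => by simpa using hLq 1 hQ.1 x
  set m : Fin d → ℕ → ℝ := fun i n => √(L (a i ^ (2 * n)))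
  have hm : ∀ i, QAWeight (m i) := fun i => qaWeight_sqrt hL hL1 (hqa i)
  let π : MvPolynomial (Fin d) ℝ →ₐ[ℝ] A := MvPolynomial.aeval a
  have hsurj : Function.Surjective π := aeval_surjective_of_adjoin_eq_top hgen
  have hℓ : TamePos m (L ∘ₗ π.toLinearMap) := by
    have := tamePos_mulLeft hL a (q := 1) (by simpa using hL)
    simpa using this
  have he := isClosedEmbedding_charPoint hgen
  have hme := he.measurableEmbedding
  obtain ⟨μ, hμ, hmom, hsupp⟩ := hℓ.exists_mvTame_support hm
    {q | ∀ x, 0 ≤ L (π q * x ^ 2)} fun q hq => by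
      have := tamePos_mulLeft hL a hq
      refine ⟨fun p => ?_, fun p i => ?_⟩
      · simpa [π] using this.nonneg p
      · simpa [π] using this.bound p i
  have hfin := hμ.finite
  have hZ : {x : Fin d → ℝ | ∀ q ∈ {q | ∀ x, 0 ≤ L (π q * x ^ 2)}, 0 ≤ MvPolynomial.eval x q}
      ⊆ charPoint a '' {α : A →ₐ[ℝ] ℝ | ∀ q ∈ Q, 0 ≤ α q} := by
    intro x hx
    have hxr : x ∈ Set.range (charPoint a) := by
      rw [range_charPoint hgen]
      intro p hp
      have hp0 : π p = 0 := hp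
      refine le_antisymm ?_ (hx p fun x => by simp [hp0])
      have := hx (-p) fun x => by simp [hp0]
      simpa using this
    obtain ⟨α, rfl⟩ := hxr
    refine ⟨α, fun q hq => ?_, rfl⟩
    obtain ⟨p, rfl⟩ := hsurj q
    have := hx p (hLq _ hq)
    rwa [eval_charPoint] at this
  have hpol : PolishSpace (A →ₐ[ℝ] ℝ) := he.polishSpace
  have hmap : (μ.comap (charPoint a)).map (charPoint a) = μ := by
    rw [hme.map_comap, Measure.restrict_eq_self_of_ae_mem]
    refine measure_mono_null (Set.compl_subset_compl.2 ?_) hsupp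
    exact hZ.trans (Set.image_subset_range _ _)
  have hfin' : IsFiniteMeasure (μ.comap (charPoint a)) :=
    ⟨by rw [hme.comap_apply]; exact measure_lt_top _ _⟩
  have huniq : ∀ ν₁ ν₂, IsRepr L {α : A →ₐ[ℝ] ℝ | ∀ q ∈ Q, 0 ≤ α q} ν₁ →
      IsRepr L {α : A →ₐ[ℝ] ℝ | ∀ q ∈ Q, 0 ≤ α q} ν₂ → ν₁ = ν₂ := fun ν₁ ν₂ h₁ h₂ => by
    have h₁' := h₁.map_charPoint hgen hℓ
    have h₂' := h₂.map_charPoint hgen hℓ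
    rw [← hme.comap_map ν₁, ← hme.comap_map ν₂,
      MvTame.ext hm h₁'.1 h₂'.1 fun p => by rw [h₁'.2, h₂'.2]]
  have hrepr : IsRepr L {α : A →ₐ[ℝ] ℝ | ∀ q ∈ Q, 0 ≤ α q} (μ.comap (charPoint a)) := by
    refine ⟨⟨inferInstance, inferInstance⟩, ?_, fun b => ?_⟩
    · rw [hme.comap_apply]
      refine measure_mono_null ?_ hsupp
      rintro _ ⟨α, hα, rfl⟩ hxZ
      obtain ⟨β, hβ, hαβ⟩ := hZ hxZ
      exact hα (hme.injective hαβ ▸ hβ)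
    · obtain ⟨p, rfl⟩ := hsurj b
      have h1 : (fun α : A →ₐ[ℝ] ℝ => α (π p))
          = (fun x => MvPolynomial.eval x p) ∘ charPoint a :=
        funext fun α => (eval_charPoint a α p).symm
      constructor
      · rw [h1, ← hme.integrable_map_iff, hmap]
        exact hμ.integrable p
      · rw [h1]
        have := hme.integral_map (μ := μ.comap (charPoint a)) fun x => MvPolynomial.eval x p
        rw [hmap, hmom] at this
        exact this
  exact ⟨_, hrepr, fun ν hν => huniq _ _ hν hrepr⟩

end Stmt18
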